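/- There exists c* > 0 such that for every c_0 with 0 < c_0 < c* there is a positive integer n_0 with the following property. Let H be a 3-graph on n > n_0 vertices and let s be an integer with 13n/45 ≤ s ≤ (1 − c_0)n/3. If ν(H) ≤ s and e(H) > binom(3s+1, 3) + 3s(n − 3s − 1), then H is a subgraph of D^3_{n,s}, i.e., there is a vertex set U of size 3s+2 containing every edge of H. -/

import Mathlib

open Finset

/-- The edge set of the complete `k`-uniform hypergraph on vertex set `Fin n`. -/
def completeEdges (n k : ℕ) : Finset (Finset (Fin n)) :=
  Finset.powersetCard k Finset.univ

/-- A family of finsets is a matching if its members are pairwise disjoint. -/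
def IsMatchingFam {α : Type*} [DecidableEq α] (M : Finset (Finset α)) : Prop :=
  (M : Set (Finset α)).Pairwise Disjoint

section Matchings

variable {α : Type*} [DecidableEq α]

lemma IsMatchingFam.insert {M : Finset (Finset α)} (hM : IsMatchingFam M) {e : Finset α}
    (he : Disjoint e (M.biUnion id)) : IsMatchingFam (insert e M) := by
  rw [disjoint_biUnion_right] at he
  unfold IsMatchingFam
  rw [coe_insert]
  exact Set.Pairwise.insert hM fun b hb _ => ⟨he b hb, (he b hb).symm⟩

lemma notMem_of_disjoint_biUnion {M : Finset (Finset α)} {e : Finset α}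
    (he : Disjoint e (M.biUnion id)) (hne : e.Nonempty) : e ∉ M := by
  intro h
  have := (disjoint_biUnion_right _ _ _).1 he e h
  simp only [id, disjoint_self, bot_eq_empty] at this
  exact hne.ne_empty this

lemma sum_card_filter_sdiff (V : Finset α) (X : Finset (Finset α))
    (hX : X ⊆ powersetCard 3 V) :
    ∑ T ∈ powersetCard 3 V, #{e ∈ X | e ⊆ V \ T} = #X * (#V - 3).choose 3 := by
  have h := sum_card_bipartiteAbove_eq_sum_card_bipartiteBelow
    (s := powersetCard 3 V) (t := X) (fun T e => e ⊆ V \ T)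
  unfold bipartiteAbove bipartiteBelow at h
  rw [h, ← smul_eq_mul, ← sum_const]
  refine sum_congr rfl fun e he => ?_
  have he' := mem_powersetCard.1 (hX he)
  rw [← he'.2, ← card_sdiff_of_subset he'.1, he'.2, ← card_powersetCard]
  congr 1
  ext T
  simp only [mem_filter, mem_powersetCard, subset_sdiff]
  constructor
  · rintro ⟨⟨h1, h2⟩, h3, h4⟩
    exact ⟨⟨h1, h4.symm⟩, h2⟩
  · rintro ⟨⟨h1, h4⟩, h2⟩
    exact ⟨⟨h1, h2⟩, he'.1, h4.symm⟩

lemma choose_three_mul (m : ℕ) :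
    (3 * m + 3).choose 3 = (m + 1) * (3 * m + 2).choose 2 := by
  have h := Nat.add_one_mul_choose_eq (3 * m + 2) 2
  nlinarith

/-- Averaging: a set of `3 * m` vertices has a partition into triples which contains at most an
average number of triples from a given family. -/
lemma exists_partition_few_missing (m : ℕ) (V : Finset α) (hV : #V = 3 * m)
    (X : Finset (Finset α)) (hX : X ⊆ powersetCard 3 V) :
    ∃ M ⊆ powersetCard 3 V, IsMatchingFam M ∧ #M = m ∧
      #(M ∩ X) * (3 * m - 1).choose 2 ≤ #X := by
  induction m generalizing V X with
  | zero => exact ⟨∅, by simp, by simp [IsMatchingFam], rfl, by simp⟩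
  | succ m ih =>
    have hT : ∀ T ∈ powersetCard 3 V, ∃ M ⊆ powersetCard 3 (V \ T), IsMatchingFam M ∧ #M = m ∧
        #(M ∩ X) * (3 * m - 1).choose 2 ≤ #{e ∈ X | e ⊆ V \ T} := by
      intro T hT
      rw [mem_powersetCard] at hT
      obtain ⟨M, h1, h2, h3, h4⟩ := ih (V \ T) (by rw [card_sdiff_of_subset hT.1]; omega)
        {e ∈ X | e ⊆ V \ T} (fun e he => by
          rw [mem_filter] at he
          exact mem_powersetCard.2 ⟨he.2, (mem_powersetCard.1 (hX he.1)).2⟩)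
      refine ⟨M, h1, h2, h3, ?_⟩
      convert h4 using 3
      ext e
      simp only [mem_inter, mem_filter]
      exact ⟨fun h => ⟨h.1, h.2, (mem_powersetCard.1 (h1 h.1)).1⟩, fun h => ⟨h.1, h.2.1⟩⟩
    choose! F hF1 hF2 hF3 hF4 using hT
    by_contra! hcon
    have hlt : ∀ T ∈ powersetCard 3 V,
        #X < ((if T ∈ X then 1 else 0) + #(F T ∩ X)) * (3 * m + 2).choose 2 := by
      intro T hT
      have hT' := mem_powersetCard.1 hT
      have hdis : Disjoint T ((F T).biUnion id) := by
        rw [disjoint_biUnion_right]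
        intro e he
        have := (mem_powersetCard.1 (hF1 T hT he)).1
        exact disjoint_of_subset_right this disjoint_sdiff
      have hnot : T ∉ F T := notMem_of_disjoint_biUnion hdis (card_pos.1 (by omega))
      have := hcon (insert T (F T)) (by
        refine insert_subset hT ((hF1 T hT).trans (powersetCard_mono sdiff_subset)))
        ((hF2 T hT).insert hdis) (by rw [card_insert_of_notMem hnot, hF3 T hT])
      refine this.trans_le ?_
      rw [show 3 * (m + 1) - 1 = 3 * m + 2 by omega]
      gcongr
      split_ifs with hTX
      · rw [insert_inter_of_mem hTX]
        exact (card_insert_le _ _).trans (by omega)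
      · rw [insert_inter_of_notMem hTX]; omega
    have hsum := sum_lt_sum_of_nonempty (powersetCard_nonempty.2 (by omega)) hlt
    rw [← sum_mul, sum_add_distrib, sum_const, card_powersetCard, smul_eq_mul, hV,
      show 3 * (m + 1) = 3 * m + 3 by ring, choose_three_mul, ← card_filter,
      filter_mem_eq_inter, inter_eq_right.2 hX] at hsum
    have hk : ∑ T ∈ powersetCard 3 V, #(F T ∩ X) ≤ #X * m := by
      rcases m with _ | m
      · have : ∀ T ∈ powersetCard 3 V, #(F T ∩ X) = 0 := fun T hT => by
          have := card_le_card (inter_subset_left (s₁ := F T) (s₂ := X))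
          rw [hF3 T hT] at this; omega
        rw [sum_eq_zero this]; omega
      · have h1 := sum_le_sum hF4
        rw [← sum_mul, sum_card_filter_sdiff V X hX, hV,
          show 3 * (m + 1 + 1) - 3 = 3 * m + 3 by omega, choose_three_mul,
          show 3 * (m + 1) - 1 = 3 * m + 2 by omega, ← mul_assoc] at h1
        exact Nat.le_of_mul_le_mul_right h1 (Nat.choose_pos (by omega))
    have hpos : 0 < (3 * m + 2).choose 2 := Nat.choose_pos (by omega)
    have : (#X + ∑ T ∈ powersetCard 3 V, #(F T ∩ X)) * (3 * m + 2).choose 2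
        ≤ (#X + #X * m) * (3 * m + 2).choose 2 := by gcongr
    nlinarith

end Matchings

lemma nonneg_of_forall_affine_nonneg {a b : ℝ} (h : ∀ M : ℝ, 0 ≤ M → 0 ≤ a + M * b) : 0 ≤ b := by
  by_contra! hb
  have := h ((|a| + 1) / -b) (by apply div_nonneg <;> [positivity; linarith])
  have e : (|a| + 1) / -b * b = -(|a| + 1) := by
    have := hb.ne
    field_simp
  rw [e] at this
  linarith [le_abs_self a]

/-- Linear programming duality for fractional packings and coverings. -/
lemma exists_fractional_packing_cover {ι κ : Type*} [Fintype ι] [Fintype κ]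
    (A : ι → κ → ℝ) (hA : ∀ T v, 0 ≤ A T v) (hA1 : ∀ T, ∃ v, 1 ≤ A T v) :
    ∃ (m : ι → ℝ) (w : κ → ℝ), (∀ T, 0 ≤ m T) ∧ (∀ v, 0 ≤ w v) ∧
      (∀ v, ∑ T, m T * A T v ≤ 1) ∧ (∀ T, 1 ≤ ∑ v, w v * A T v) ∧ ∑ T, m T = ∑ v, w v := by
  classical
  set P : Set (ι → ℝ) := {m | (∀ T, 0 ≤ m T) ∧ ∀ v, ∑ T, m T * A T v ≤ 1} with hP
  have hPc : IsCompact P := by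
    apply (isCompact_Icc (a := (0 : ι → ℝ)) (b := fun _ => 1)).of_isClosed_subset
    · rw [hP, Set.ofPred_and, Set.ofPred_forall, Set.ofPred_forall]
      refine IsClosed.inter (isClosed_iInter fun T => ?_) (isClosed_iInter fun v => ?_)
      · exact isClosed_le continuous_const (continuous_apply T)
      · exact isClosed_le (by fun_prop) continuous_const
    · intro m hm
      refine ⟨fun T => hm.1 T, fun T => ?_⟩
      obtain ⟨v, hv⟩ := hA1 T
      have h1 := single_le_sum (f := fun T => m T * A T v)
        (fun T _ => mul_nonneg (hm.1 T) (hA T v)) (mem_univ T)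
      have h2 := hm.2 v
      have h3 : m T * 1 ≤ m T * A T v := mul_le_mul_of_nonneg_left hv (hm.1 T)
      simp only at h1 ⊢
      linarith
  obtain ⟨m, hmP, hmax⟩ := hPc.exists_isMaxOn (f := fun m => ∑ T, m T)
    ⟨0, by simp [hP]⟩ (by fun_prop)
  set ν := ∑ T, m T with hν
  set C : Set ((κ → ℝ) × ℝ) :=
    {p | ∃ m : ι → ℝ, (∀ T, 0 ≤ m T) ∧ (∀ v, ∑ T, m T * A T v - 1 ≤ p.1 v) ∧ p.2 ≤ ∑ T, m T - ν}
    with hC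
  set D : Set ((κ → ℝ) × ℝ) := {p | (∀ v, p.1 v < 0) ∧ 0 < p.2} with hD
  have hDo : IsOpen D := by
    rw [hD, Set.ofPred_and, Set.ofPred_forall]
    refine IsOpen.inter (isOpen_iInter_of_finite fun v => ?_) ?_
    · exact isOpen_lt (by fun_prop) continuous_const
    · exact isOpen_lt continuous_const continuous_snd
  have hDc : Convex ℝ D := by
    rintro ⟨y, t⟩ ⟨hy, ht⟩ ⟨y', t'⟩ ⟨hy', ht'⟩ a b ha hb hab
    refine ⟨fun v => ?_, ?_⟩
    · have := hy v; have := hy' v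
      simp only [Prod.fst_add, Prod.smul_fst, Pi.add_apply, Pi.smul_apply, smul_eq_mul] at *
      rcases ha.eq_or_lt with rfl | ha
      · have : b = 1 := by linarith
        subst this; linarith
      · nlinarith
    · simp only [Prod.snd_add, Prod.smul_snd, smul_eq_mul] at *
      rcases ha.eq_or_lt with rfl | ha
      · have : b = 1 := by linarith
        subst this; linarith
      · nlinarith
  have hCc : Convex ℝ C := by
    rintro ⟨y, t⟩ ⟨m₁, h1, h2, h3⟩ ⟨y', t'⟩ ⟨m₂, h1', h2', h3'⟩ a b ha hb hab
    refine ⟨fun T => a * m₁ T + b * m₂ T, fun T => ?_, fun v => ?_, ?_⟩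
    · have := h1 T; have := h1' T; positivity
    · have e : ∑ T, (a * m₁ T + b * m₂ T) * A T v
          = a * ∑ T, m₁ T * A T v + b * ∑ T, m₂ T * A T v := by
        rw [mul_sum, mul_sum, ← sum_add_distrib]; exact sum_congr rfl fun _ _ => by ring
      have := mul_le_mul_of_nonneg_left (h2 v) ha
      have := mul_le_mul_of_nonneg_left (h2' v) hb
      simp only [Prod.fst_add, Prod.smul_fst, Pi.add_apply, Pi.smul_apply, smul_eq_mul] at *
      rw [e]; linarith
    · have e : ∑ T, (a * m₁ T + b * m₂ T) = a * ∑ T, m₁ T + b * ∑ T, m₂ T := by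
        rw [mul_sum, mul_sum, ← sum_add_distrib]
      have := mul_le_mul_of_nonneg_left h3 ha
      have := mul_le_mul_of_nonneg_left h3' hb
      simp only [Prod.snd_add, Prod.smul_snd, smul_eq_mul] at *
      have e2 : a * ν + b * ν = ν := by rw [← add_mul, hab, one_mul]
      rw [e]; linarith
  have hdisj : Disjoint D C := by
    rw [Set.disjoint_left]
    rintro ⟨y, t⟩ ⟨hy, ht⟩ ⟨m', h1, h2, h3⟩
    have hm' : m' ∈ P := ⟨h1, fun v => by linarith [h2 v, hy v]⟩
    have := hmax hm'
    simp only [Set.mem_ofPred_eq] at this h3 ht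
    linarith
  obtain ⟨f, u, hfD, hfC⟩ := geometric_hahn_banach_open hDc hDo hCc hdisj
  set ω : κ → ℝ := fun v => f (Pi.single v 1, 0) with hω
  set l : ℝ := - f (0, 1) with hl
  have hf : ∀ y t, f (y, t) = ∑ v, ω v * y v - l * t := by
    intro y t
    have e : ((y, t) : (κ → ℝ) × ℝ)
        = ∑ v, y v • ((Pi.single v 1 : κ → ℝ), (0 : ℝ)) + t • ((0 : κ → ℝ), (1 : ℝ)) := by
      ext v
      · simp [Prod.fst_sum, Finset.sum_apply, Pi.single_apply]
      · simp [Prod.snd_sum]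
    rw [e, map_add, map_sum, map_smul]
    simp only [map_smul, smul_eq_mul, hω, hl]
    rw [sum_congr rfl fun v _ => mul_comm (y v) _]
    ring
  have hu : 0 ≤ u := by
    by_contra! hu
    have h1 : ∀ ε : ℝ, 0 < ε → -ε * (∑ v, ω v + l) < u := by
      intro ε hε
      have := hfD (fun _ => -ε, ε) ⟨fun _ => by simpa using hε, hε⟩
      rw [hf, ← sum_mul] at this
      linarith
    have hS : 0 < ∑ v, ω v + l := by nlinarith [h1 1 one_pos]
    have := h1 (-u / (2 * (∑ v, ω v + l))) (by apply div_pos <;> linarith)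
    have e : -(-u / (2 * (∑ v, ω v + l))) * (∑ v, ω v + l) = u / 2 := by field_simp
    rw [e] at this
    linarith
  have key : ∀ (m' : ι → ℝ) (y : κ → ℝ) (t : ℝ), (∀ T, 0 ≤ m' T) →
      (∀ v, ∑ T, m' T * A T v - 1 ≤ y v) → t ≤ ∑ T, m' T - ν → 0 ≤ ∑ v, ω v * y v - l * t := by
    intro m' y t h1 h2 h3
    rw [← hf]
    exact hu.trans (hfC _ ⟨m', h1, h2, h3⟩)
  have hω0 : ∀ v, 0 ≤ ω v := by
    intro v
    refine nonneg_of_forall_affine_nonneg (a := -∑ v, ω v + l * ν) fun M hM => ?_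
    have := key 0 (fun v' => -1 + M * (Pi.single v 1 : κ → ℝ) v') (-ν) (by simp) (fun v' => by
      by_cases h : v' = v
      · subst h; simp [hM]
      · simp [h]) (by simp)
    simp only [mul_add, sum_add_distrib, ← mul_assoc, mul_comm _ M] at this
    simp [Pi.single_apply, mul_comm] at this
    linarith
  have hl0 : 0 ≤ l := by
    refine nonneg_of_forall_affine_nonneg (a := -∑ v, ω v + l * ν) fun M hM => ?_
    have := key 0 (fun _ => -1) (-ν - M) (by simp) (by simp) (by simp [hM])
    simp at this
    linarith
  have hsum : ∑ v, ω v ≤ l * ν := by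
    have := key 0 (fun _ => -1) (-ν) (by simp) (by simp) (by simp)
    simp at this
    linarith
  have hlpos : 0 < l := by
    refine lt_of_le_of_ne hl0 fun h0 => ?_
    rw [← h0, zero_mul] at hsum
    have hz : ∀ v, ω v = 0 := fun v =>
      le_antisymm ((single_le_sum (fun v _ => hω0 v) (mem_univ v)).trans hsum) (hω0 v)
    have h1 := hfD (fun _ => -1, 1) ⟨fun _ => by norm_num, by norm_num⟩
    have h2 := hfC (fun _ => -1, -ν) ⟨0, by simp, by simp, by simp⟩
    rw [hf] at h1 h2
    simp [hz, ← h0] at h1 h2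
    linarith
  have hcov : ∀ T, l ≤ ∑ v, ω v * A T v := by
    intro T
    suffices 0 ≤ ∑ v, ω v * A T v - l by linarith
    refine nonneg_of_forall_affine_nonneg (a := -∑ v, ω v + l * ν) fun M hM => ?_
    have := key (fun T' => M * (Pi.single T 1 : ι → ℝ) T') (fun v => M * A T v - 1) (M - ν)
      (fun T' => mul_nonneg hM (by by_cases h : T' = T <;> simp [h]))
      (fun v => by simp [Pi.single_apply]) (by simp [Pi.single_apply])
    simp only [mul_sub, sum_sub_distrib] at this
    have e : ∑ v, ω v * (M * A T v) = M * ∑ v, ω v * A T v := by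
      rw [mul_sum]; exact sum_congr rfl fun _ _ => by ring
    rw [e] at this
    simp at this
    linarith
  have hcov' : ∀ T, 1 ≤ ∑ v, ω v / l * A T v := by
    intro T
    have e : ∑ v, ω v / l * A T v = (∑ v, ω v * A T v) / l := by
      rw [sum_div]; exact sum_congr rfl fun _ _ => by ring
    rw [e, le_div_iff₀ hlpos, one_mul]
    exact hcov T
  have hw0 : ∀ v, 0 ≤ ω v / l := fun v => div_nonneg (hω0 v) hl0
  refine ⟨m, fun v => ω v / l, hmP.1, hw0, hmP.2, hcov', le_antisymm ?_ ?_⟩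
  · calc ∑ T, m T ≤ ∑ T, m T * ∑ v, ω v / l * A T v :=
          sum_le_sum fun T _ => le_mul_of_one_le_right (hmP.1 T) (hcov' T)
      _ = ∑ v, ω v / l * ∑ T, m T * A T v := by
          simp only [mul_sum]
          rw [sum_comm]
          exact sum_congr rfl fun _ _ => sum_congr rfl fun _ _ => by ring
      _ ≤ ∑ v, ω v / l := sum_le_sum fun v _ => mul_le_of_le_one_right (hw0 v) (hmP.2 v)
  · rw [← sum_div, div_le_iff₀ hlpos]
    linarith

/-- Indicator of `1 ≤ x`. -/
noncomputable def atLeastOne (x : ℝ) : ℝ := if 1 ≤ x then 1 else 0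

lemma atLeastOne_nonneg (x : ℝ) : 0 ≤ atLeastOne x := by
  unfold atLeastOne; split_ifs <;> norm_num

lemma atLeastOne_le_one (x : ℝ) : atLeastOne x ≤ 1 := by
  unfold atLeastOne; split_ifs <;> norm_num

/-- A `3 × 3` grid of sums of total `3` per transversal has two small entries unless the first
summand is constant. -/
lemma sum_grid_le_seven (a d : Fin 3 → ℝ) (h : ∑ i, a i + ∑ i, d i = 3)
    (ha : ¬ (a 0 = a 1 ∧ a 1 = a 2)) :
    ∑ i, ∑ j, atLeastOne (a i + d j) ≤ 7 := by
  simp only [Fin.sum_univ_three] at *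
  unfold atLeastOne
  by_contra! hc
  apply ha
  split_ifs at hc <;> first
    | (exfalso; revert hc; norm_num; done)
    | (constructor <;> linarith)

lemma sum_cube_le_of_not_const (a b c : Fin 3 → ℝ)
    (ha : ∑ i, a i = 1) (hb : ∑ i, b i = 1) (hc : ∑ i, c i = 1)
    (hn : ¬ (a 0 = a 1 ∧ a 1 = a 2)) :
    ∑ i, ∑ j, ∑ k, atLeastOne (a i + b j + c k) ≤ 21 := by
  have key : ∀ r : Fin 3, ∑ i, ∑ j, atLeastOne (a i + (b j + c (j + r))) ≤ 7 := by
    intro r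
    refine sum_grid_le_seven a (fun j => b j + c (j + r)) ?_ hn
    rw [Finset.sum_add_distrib, ha, hb]
    have : ∑ j, c (j + r) = ∑ j, c j := Equiv.sum_comp (Equiv.addRight r) c
    rw [this, hc]; norm_num
  have h0 := key 0
  have h1 := key 1
  have h2 := key 2
  simp only [Fin.sum_univ_three] at *
  simp only [← add_assoc] at *
  norm_num at *
  simp only [show (2 : Fin 3) + 1 = 0 from rfl, show (1 : Fin 3) + 1 = 2 from rfl,
    show (2 : Fin 3) + 2 = 1 from rfl, show (1 : Fin 3) + 2 = 0 from rfl] at *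
  linarith

lemma sum_cube_swap_left (a b c : Fin 3 → ℝ) :
    ∑ i, ∑ j, ∑ k, atLeastOne (a i + b j + c k) =
      ∑ i, ∑ j, ∑ k, atLeastOne (b i + a j + c k) := by
  rw [Finset.sum_comm]
  simp only [add_comm (b _) (a _)]

lemma sum_cube_rotate (a b c : Fin 3 → ℝ) :
    ∑ i, ∑ j, ∑ k, atLeastOne (a i + b j + c k) =
      ∑ i, ∑ j, ∑ k, atLeastOne (c i + a j + b k) := by
  simp only [Fin.sum_univ_three, add_comm (c _) (a _)]
  ring_nf

lemma sum_cube_le (a b c : Fin 3 → ℝ)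
    (ha : ∑ i, a i = 1) (hb : ∑ i, b i = 1) (hc : ∑ i, c i = 1)
    (hn : ¬ ((∀ i, a i = 1 / 3) ∧ (∀ i, b i = 1 / 3) ∧ (∀ i, c i = 1 / 3))) :
    ∑ i, ∑ j, ∑ k, atLeastOne (a i + b j + c k) ≤ 21 := by
  have const : ∀ f : Fin 3 → ℝ, ∑ i, f i = 1 → (f 0 = f 1 ∧ f 1 = f 2) → ∀ i, f i = 1 / 3 := by
    intro f hf h i
    rw [Fin.sum_univ_three] at hf
    fin_cases i <;> simp <;> linarith [h.1, h.2]
  by_cases h1 : a 0 = a 1 ∧ a 1 = a 2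
  · by_cases h2 : b 0 = b 1 ∧ b 1 = b 2
    · by_cases h3 : c 0 = c 1 ∧ c 1 = c 2
      · exact absurd ⟨const a ha h1, const b hb h2, const c hc h3⟩ hn
      · rw [sum_cube_rotate]; exact sum_cube_le_of_not_const c a b hc ha hb h3
    · rw [sum_cube_swap_left]; exact sum_cube_le_of_not_const b a c hb ha hc h2
  · exact sum_cube_le_of_not_const a b c ha hb hc h1

lemma sum_pair_le_five (a b : Fin 3 → ℝ) (ha : ∑ i, a i = 1) (hb : ∑ i, b i = 1)
    (ha0 : ∀ i, 0 ≤ a i) (hb0 : ∀ i, 0 ≤ b i) :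
    ∑ i, ∑ j, atLeastOne (a i + b j) ≤ 5 := by
  have := ha0 0; have := ha0 1; have := ha0 2
  have := hb0 0; have := hb0 1; have := hb0 2
  simp only [Fin.sum_univ_three] at *
  unfold atLeastOne
  by_contra! hc
  split_ifs at hc <;> first
    | (revert hc; norm_num; done)
    | linarith

set_option maxHeartbeats 1000000 in
lemma sum_pair_le_four (a b : Fin 3 → ℝ) (ha : ∑ i, a i = 1) (hb : ∑ i, b i = 1)
    (ha0 : ∀ i, 0 ≤ a i) (hb0 : ∀ i, 0 ≤ b i) (ha1 : ∀ i, a i < 1) (hb1 : ∀ i, b i < 1) :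
    ∑ i, ∑ j, atLeastOne (a i + b j) ≤ 4 := by
  have := ha0 0; have := ha0 1; have := ha0 2
  have := hb0 0; have := hb0 1; have := hb0 2
  have := ha1 0; have := ha1 1; have := ha1 2
  have := hb1 0; have := hb1 1; have := hb1 2
  simp only [Fin.sum_univ_three] at *
  unfold atLeastOne
  by_contra! hc
  split_ifs at hc <;> first
    | (revert hc; norm_num; done)
    | linarith

lemma sum_atLeastOne_le_one (a : Fin 3 → ℝ) (ha : ∑ i, a i = 1) (ha0 : ∀ i, 0 ≤ a i) :
    ∑ i, atLeastOne (a i) ≤ 1 := by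
  have := ha0 0; have := ha0 1; have := ha0 2
  simp only [Fin.sum_univ_three] at *
  unfold atLeastOne
  by_contra! hc
  split_ifs at hc <;> first
    | (revert hc; norm_num; done)
    | linarith

lemma eq_zero_of_one_le {a : Fin 3 → ℝ} (ha : ∑ i, a i = 1) (ha0 : ∀ i, 0 ≤ a i) {i j : Fin 3}
    (hi : 1 ≤ a i) (hij : j ≠ i) : a j = 0 := by
  have := Finset.add_le_sum (fun k _ => ha0 k) (mem_univ i) (mem_univ j) hij.symm
  linarith [ha0 j]

lemma sum_cube_le_of_one_le (a b c : Fin 3 → ℝ)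
    (ha : ∑ i, a i = 1) (hb : ∑ i, b i = 1) (hc : ∑ i, c i = 1)
    (ha0 : ∀ i, 0 ≤ a i) (hb0 : ∀ i, 0 ≤ b i) (hc0 : ∀ i, 0 ≤ c i) (h : ∃ i, 1 ≤ a i) :
    ∑ i, ∑ j, ∑ k, atLeastOne (a i + b j + c k) ≤ 19 := by
  obtain ⟨i, hi⟩ := h
  have hp := sum_pair_le_five b c hb hc hb0 hc0
  have h9 : ∑ j, ∑ k, atLeastOne (a i + b j + c k) ≤ 9 := by
    calc _ ≤ ∑ j : Fin 3, ∑ k : Fin 3, (1 : ℝ) :=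
          sum_le_sum fun j _ => sum_le_sum fun k _ => atLeastOne_le_one _
      _ = 9 := by norm_num
  have hr : ∀ j ≠ i, ∑ l, ∑ k, atLeastOne (a j + b l + c k) ≤ 5 := by
    intro j hj
    simpa [eq_zero_of_one_le ha ha0 hi hj] using hp
  rw [Fin.sum_univ_three]
  obtain rfl | rfl | rfl : i = 0 ∨ i = 1 ∨ i = 2 := by fin_cases i <;> simp
  · linarith [hr 1 (by decide), hr 2 (by decide)]
  · linarith [hr 0 (by decide), hr 2 (by decide)]
  · linarith [hr 0 (by decide), hr 1 (by decide)]

/-- Weighted number of triples with sum at least one, each entry coming from one of three given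
vectors or being a zero of weight `τ`. -/
noncomputable def localWeight (τ : ℝ) (a b c : Fin 3 → ℝ) : ℝ :=
  ∑ i, ∑ j, ∑ k, atLeastOne (a i + b j + c k)
    + τ * (∑ i, ∑ j, atLeastOne (a i + b j) + ∑ i, ∑ j, atLeastOne (a i + c j)
      + ∑ i, ∑ j, atLeastOne (b i + c j))
    + τ ^ 2 * (∑ i, atLeastOne (a i) + ∑ i, atLeastOne (b i) + ∑ i, atLeastOne (c i))

lemma localWeight_le (τ : ℝ) (hτ : 0 ≤ τ) (a b c : Fin 3 → ℝ)
    (ha : ∑ i, a i = 1) (hb : ∑ i, b i = 1) (hc : ∑ i, c i = 1)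
    (ha0 : ∀ i, 0 ≤ a i) (hb0 : ∀ i, 0 ≤ b i) (hc0 : ∀ i, 0 ≤ c i)
    (hn : ¬ ((∀ i, a i = 1 / 3) ∧ (∀ i, b i = 1 / 3) ∧ (∀ i, c i = 1 / 3))) :
    localWeight τ a b c ≤ max (21 + 12 * τ) (19 + 15 * τ + 3 * τ ^ 2) := by
  unfold localWeight
  by_cases h : (∃ i, 1 ≤ a i) ∨ (∃ i, 1 ≤ b i) ∨ (∃ i, 1 ≤ c i)
  · apply le_max_of_le_right
    have h3 : ∑ i, ∑ j, ∑ k, atLeastOne (a i + b j + c k) ≤ 19 := by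
      rcases h with h | h | h
      · exact sum_cube_le_of_one_le a b c ha hb hc ha0 hb0 hc0 h
      · rw [sum_cube_swap_left]; exact sum_cube_le_of_one_le b a c hb ha hc hb0 ha0 hc0 h
      · rw [sum_cube_rotate]; exact sum_cube_le_of_one_le c a b hc ha hb hc0 ha0 hb0 h
    have e1 := sum_pair_le_five a b ha hb ha0 hb0
    have e2 := sum_pair_le_five a c ha hc ha0 hc0
    have e3 := sum_pair_le_five b c hb hc hb0 hc0
    have f1 := sum_atLeastOne_le_one a ha ha0
    have f2 := sum_atLeastOne_le_one b hb hb0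
    have f3 := sum_atLeastOne_le_one c hc hc0
    have g1 := mul_le_mul_of_nonneg_left (add_le_add (add_le_add e1 e2) e3) hτ
    have g2 := mul_le_mul_of_nonneg_left (add_le_add (add_le_add f1 f2) f3) (sq_nonneg τ)
    linarith
  · apply le_max_of_le_left
    push Not at h
    obtain ⟨ha1, hb1, hc1⟩ := h
    have h3 := sum_cube_le a b c ha hb hc hn
    have e1 := sum_pair_le_four a b ha hb ha0 hb0 ha1 hb1
    have e2 := sum_pair_le_four a c ha hc ha0 hc0 ha1 hc1
    have e3 := sum_pair_le_four b c hb hc hb0 hc0 hb1 hc1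
    have zero : ∀ f : Fin 3 → ℝ, (∀ i, f i < 1) → ∑ i, atLeastOne (f i) = 0 := fun f hf =>
      sum_eq_zero fun i _ => if_neg (hf i).not_ge
    rw [zero a ha1, zero b hb1, zero c hc1]
    have g1 := mul_le_mul_of_nonneg_left (add_le_add (add_le_add e1 e2) e3) hτ
    linarith

lemma localWeight_third (τ : ℝ) (a b c : Fin 3 → ℝ)
    (ha : ∀ i, a i = 1 / 3) (hb : ∀ i, b i = 1 / 3) (hc : ∀ i, c i = 1 / 3) :
    localWeight τ a b c = 27 := by
  simp only [localWeight, ha, hb, hc, atLeastOne]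
  norm_num

/-- Local estimate for few unsaturated vertices. -/
lemma localWeight_le_of_le (τ : ℝ) (hτ : 0 ≤ τ) (hτ' : τ ≤ 47 / 100) (a b c : Fin 3 → ℝ)
    (ha : ∑ i, a i = 1) (hb : ∑ i, b i = 1) (hc : ∑ i, c i = 1)
    (ha0 : ∀ i, 0 ≤ a i) (hb0 : ∀ i, 0 ≤ b i) (hc0 : ∀ i, 0 ≤ c i)
    (hn : ¬ ((∀ i, a i = 1 / 3) ∧ (∀ i, b i = 1 / 3) ∧ (∀ i, c i = 1 / 3))) :
    localWeight τ a b c ≤ 27 - 1 / 4 := by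
  refine (localWeight_le τ hτ a b c ha hb hc ha0 hb0 hc0 hn).trans (max_le ?_ ?_) <;> nlinarith

/-- Local estimate for many unsaturated vertices. -/
lemma localWeight_le_of_ge (τ : ℝ) (hτ : 47 / 100 ≤ τ) (a b c : Fin 3 → ℝ)
    (ha : ∑ i, a i = 1) (hb : ∑ i, b i = 1) (hc : ∑ i, c i = 1)
    (ha0 : ∀ i, 0 ≤ a i) (hb0 : ∀ i, 0 ≤ b i) (hc0 : ∀ i, 0 ≤ c i) :
    localWeight τ a b c ≤ 27 * ((3 + τ) / (347 / 100)) ^ 3 := by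
  obtain ⟨u, rfl⟩ : ∃ u, τ = 47 / 100 + u := ⟨τ - 47 / 100, by ring⟩
  have hu : 0 ≤ u := by linarith
  have hu2 := pow_nonneg hu 2
  have hu3 := pow_nonneg hu 3
  by_cases hn : (∀ i, a i = 1 / 3) ∧ (∀ i, b i = 1 / 3) ∧ (∀ i, c i = 1 / 3)
  · rw [localWeight_third _ a b c hn.1 hn.2.1 hn.2.2]
    nlinarith
  · refine (localWeight_le _ (by linarith) a b c ha hb hc ha0 hb0 hc0 hn).trans (max_le ?_ ?_) <;>
      nlinarith

section Unshift

variable {α : Type*} [DecidableEq α]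

lemma card_pairs_meeting_le (P W : Finset α) :
    #{Q ∈ powersetCard 2 W | ¬Disjoint P Q} ≤ #P * #W := by
  have hsub : {Q ∈ powersetCard 2 W | ¬Disjoint P Q} ⊆
      P.biUnion fun a => W.image fun x => {a, x} := by
    intro Q hQ
    simp only [mem_filter, mem_powersetCard, not_disjoint_iff] at hQ
    obtain ⟨⟨hQW, hQ2⟩, a, haP, haQ⟩ := hQ
    obtain ⟨x, hx⟩ := card_eq_one.1 (show #(Q.erase a) = 1 by rw [card_erase_of_mem haQ, hQ2])
    have hxQ : x ∈ Q := mem_of_mem_erase (hx ▸ mem_singleton_self x)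
    simp only [mem_biUnion, mem_image]
    exact ⟨a, haP, x, hQW hxQ, by rw [← insert_erase haQ, hx]⟩
  refine (card_le_card hsub).trans (card_biUnion_le_card_mul _ _ _ fun a _ => card_image_le)

lemma card_insert_pairs (W : Finset α) (i : α) (hi : i ∉ W) (L : Finset (Finset α))
    (hL : L ⊆ powersetCard 2 W) : #(L.image (insert i)) = #L := by
  refine card_image_of_injOn fun p hp q hq h => ?_
  have hip : i ∉ p := fun h' => hi ((mem_powersetCard.1 (hL hp)).1 h')
  have hiq : i ∉ q := fun h' => hi ((mem_powersetCard.1 (hL hq)).1 h')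
  rw [← erase_insert hip, ← erase_insert hiq]
  exact congrArg (fun e => e.erase i) h

lemma exists_clique_of_split_vertex {s D : ℕ} (hD : 5 ≤ D) (hs : 2 ≤ s)
    {H : Finset (Finset α)} {W : Finset α} (hW : #W = 3 * s + 1) {i j : α} (hij : i ≠ j)
    (hi : i ∉ W) (hj : j ∉ W)
    (hH : ∀ e ∈ H, e ∈ powersetCard 3 W ∨
      ∃ p ∈ powersetCard 2 W, e = insert i p ∨ e = insert j p)
    (hdis : ∀ p ∈ powersetCard 2 W, insert i p ∈ H → insert j p ∉ H)
    (hν : ∀ M ⊆ H, IsMatchingFam M → #M ≤ s)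
    (hcard : (3 * s + 1).choose 3 + 3 * s * D < #H) :
    ∃ U : Finset α, #U = 3 * s + 2 ∧ ∀ e ∈ H, e ⊆ U := by
  set Li := {p ∈ powersetCard 2 W | insert i p ∈ H} with hLi
  set Lj := {p ∈ powersetCard 2 W | insert j p ∈ H} with hLj
  have hLiW : Li ⊆ powersetCard 2 W := filter_subset _ _
  have hLjW : Lj ⊆ powersetCard 2 W := filter_subset _ _
  by_cases hLi0 : Li = ∅
  · refine ⟨insert j W, by rw [card_insert_of_notMem hj, hW], fun e he => ?_⟩
    rcases hH e he with h | ⟨p, hp, rfl | rfl⟩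
    · exact (mem_powersetCard.1 h).1.trans (subset_insert _ _)
    · exact absurd (show p ∈ Li from mem_filter.2 ⟨hp, he⟩) (by rw [hLi0]; simp)
    · exact insert_subset_insert _ (mem_powersetCard.1 hp).1
  by_cases hLj0 : Lj = ∅
  · refine ⟨insert i W, by rw [card_insert_of_notMem hi, hW], fun e he => ?_⟩
    rcases hH e he with h | ⟨p, hp, rfl | rfl⟩
    · exact (mem_powersetCard.1 h).1.trans (subset_insert _ _)
    · exact insert_subset_insert _ (mem_powersetCard.1 hp).1
    · exact absurd (show p ∈ Lj from mem_filter.2 ⟨hp, he⟩) (by rw [hLj0]; simp)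
  exfalso
  have hcardH : #H ≤ #(H ∩ powersetCard 3 W) + (#Li + #Lj) := by
    have hsub : H ⊆ (H ∩ powersetCard 3 W) ∪ (Li.image (insert i) ∪ Lj.image (insert j)) := by
      intro e he
      rcases hH e he with h | ⟨p, hp, rfl | rfl⟩
      · exact mem_union_left _ (mem_inter.2 ⟨he, h⟩)
      · exact mem_union_right _ (mem_union_left _
          (mem_image_of_mem _ (mem_filter.2 ⟨hp, he⟩)))
      · exact mem_union_right _ (mem_union_right _
          (mem_image_of_mem _ (mem_filter.2 ⟨hp, he⟩)))
    have h1 := card_le_card hsub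
    have h2 := card_union_le (H ∩ powersetCard 3 W) (Li.image (insert i) ∪ Lj.image (insert j))
    have h3 := card_union_le (Li.image (insert i)) (Lj.image (insert j))
    rw [card_insert_pairs W i hi Li hLiW, card_insert_pairs W j hj Lj hLjW] at h3
    omega
  have hHW : #(H ∩ powersetCard 3 W) + #(powersetCard 3 W \ H) = (3 * s + 1).choose 3 := by
    rw [← hW, ← card_powersetCard, inter_comm, card_inter_add_card_sdiff]
  have hLL : #Li + #Lj ≤ (3 * s + 1).choose 2 := by
    rw [← hW, ← card_powersetCard, ← card_union_of_disjoint]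
    · exact card_le_card (union_subset hLiW hLjW)
    · rw [disjoint_left]
      intro p h1 h2
      exact hdis p (hLiW h1) (mem_filter.1 h1).2 (mem_filter.1 h2).2
  by_cases hcross : ∃ P ∈ Li, ∃ Q ∈ Lj, Disjoint P Q
  · obtain ⟨P, hP, Q, hQ, hPQ⟩ := hcross
    have hP' := mem_powersetCard.1 (hLiW hP)
    have hQ' := mem_powersetCard.1 (hLjW hQ)
    have hV : #(W \ (P ∪ Q)) = 3 * (s - 1) := by
      rw [card_sdiff_of_subset (union_subset hP'.1 hQ'.1), card_union_of_disjoint hPQ]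
      omega
    obtain ⟨M, hM1, hM2, hM3, hM4⟩ := exists_partition_few_missing (s - 1) _ hV
      (powersetCard 3 (W \ (P ∪ Q)) \ H) sdiff_subset
    have hX : #(powersetCard 3 (W \ (P ∪ Q)) \ H) ≤ #(powersetCard 3 W \ H) :=
      card_le_card (sdiff_subset_sdiff (powersetCard_mono sdiff_subset) subset_rfl)
    have hMX : M ∩ (powersetCard 3 (W \ (P ∪ Q)) \ H) = ∅ := by
      by_contra hne
      have hpos : 1 ≤ #(M ∩ (powersetCard 3 (W \ (P ∪ Q)) \ H)) :=
        card_pos.2 (nonempty_iff_ne_empty.2 hne)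
      have h1 : (3 * (s - 1) - 1).choose 2 ≤ #(powersetCard 3 W \ H) := by nlinarith
      obtain ⟨t, rfl⟩ : ∃ t, s = t + 2 := ⟨s - 2, by omega⟩
      have e1 : (3 * (t + 2) + 1).choose 2 * 2 = (3 * t + 7) * (3 * t + 6) := by
        rw [Nat.choose_two_right, Nat.div_mul_cancel (Nat.even_mul_pred_self _).two_dvd]
        congr 1
      have e2 : (3 * (t + 2 - 1) - 1).choose 2 * 2 = (3 * t + 2) * (3 * t + 1) := by
        rw [Nat.choose_two_right, Nat.div_mul_cancel (Nat.even_mul_pred_self _).two_dvd]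
        congr 1
      nlinarith
    have hMH : M ⊆ H := fun e he => by
      by_contra hne
      have : e ∈ M ∩ (powersetCard 3 (W \ (P ∪ Q)) \ H) :=
        mem_inter.2 ⟨he, mem_sdiff.2 ⟨hM1 he, hne⟩⟩
      rw [hMX] at this
      simp at this
    have hMV : M.biUnion id ⊆ W \ (P ∪ Q) :=
      biUnion_subset.2 fun e he => (mem_powersetCard.1 (hM1 he)).1
    have hd1 : Disjoint (insert i P) (M.biUnion id) := by
      refine disjoint_of_subset_right hMV ?_
      rw [disjoint_left]
      intro x hx
      simp only [mem_insert] at hx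
      simp only [mem_sdiff, mem_union]
      rcases hx with rfl | hx
      · exact fun h => hi h.1
      · exact fun h => h.2 (Or.inl hx)
    have hd2 : Disjoint (insert j Q) ((insert (insert i P) M).biUnion id) := by
      rw [biUnion_insert, disjoint_union_right]
      constructor
      · rw [disjoint_left]
        intro x hx
        simp only [mem_insert, id] at hx ⊢
        rintro (rfl | h)
        · rcases hx with h | h
          · exact hij h
          · exact hi (hQ'.1 h)
        · rcases hx with rfl | hx
          · exact hj (hP'.1 h)
          · exact disjoint_left.1 hPQ h hx
      · refine disjoint_of_subset_right hMV ?_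
        rw [disjoint_left]
        intro x hx
        simp only [mem_insert] at hx
        simp only [mem_sdiff, mem_union]
        rcases hx with rfl | hx
        · exact fun h => hj h.1
        · exact fun h => h.2 (Or.inr hx)
    have := hν (insert (insert j Q) (insert (insert i P) M))
      (insert_subset (mem_filter.1 hQ).2 (insert_subset (mem_filter.1 hP).2 hMH))
      ((hM2.insert hd1).insert hd2)
    rw [card_insert_of_notMem (notMem_of_disjoint_biUnion hd2 (insert_nonempty _ _)),
      card_insert_of_notMem (notMem_of_disjoint_biUnion hd1 (insert_nonempty _ _)), hM3] at this
    omega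
  · push Not at hcross
    obtain ⟨P, hP⟩ := nonempty_iff_ne_empty.2 hLi0
    obtain ⟨Q, hQ⟩ := nonempty_iff_ne_empty.2 hLj0
    have h1 : #Lj ≤ 2 * #W := by
      rw [← (mem_powersetCard.1 (hLiW hP)).2]
      refine (card_le_card fun q hq => ?_).trans (card_pairs_meeting_le P W)
      exact mem_filter.2 ⟨hLjW hq, hcross P hP q hq⟩
    have h2 : #Li ≤ 2 * #W := by
      rw [← (mem_powersetCard.1 (hLjW hQ)).2]
      refine (card_le_card fun q hq => ?_).trans (card_pairs_meeting_le Q W)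
      exact mem_filter.2 ⟨hLiW hq, fun h => hcross q hq Q hQ h.symm⟩
    rw [hW] at h1 h2
    nlinarith

end Unshift

section Shift

variable {n : ℕ}

open UV in
lemma mem_or_of_compression_subset {H : Finset (Finset (Fin n))} {i j : Fin n} {U : Finset (Fin n)}
    (hU : ∀ e ∈ compression {i} {j} H, e ⊆ U) {e : Finset (Fin n)} (he : e ∈ H) :
    e ⊆ U ∨ (j ∈ e ∧ i ∉ e ∧ insert i (e.erase j) ⊆ U ∧ insert i (e.erase j) ∉ H) := by
  by_cases h : compress {i} {j} e ∈ H
  · exact Or.inl (hU e (mem_compression.2 (Or.inl ⟨he, h⟩)))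
  · right
    have hc : compress {i} {j} e ∈ compression {i} {j} H :=
      mem_compression.2 (Or.inr ⟨h, e, he, rfl⟩)
    by_cases hd : Disjoint {i} e ∧ {j} ≤ e
    · have hie : i ∉ e := by simpa using hd.1
      have hje : j ∈ e := by simpa using hd.2
      have hij : i ≠ j := fun h => hie (h ▸ hje)
      have heq : compress {i} {j} e = insert i (e.erase j) := by
        rw [compress_of_disjoint_of_le hd.1 hd.2]
        ext x
        simp only [sup_eq_union, mem_sdiff, mem_union, mem_singleton, mem_insert, mem_erase]
        constructor
        · rintro ⟨h1 | h1, h2⟩ <;> tauto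
        · rintro (h1 | h1)
          · exact ⟨Or.inr h1, h1 ▸ hij⟩
          · tauto
      rw [heq] at h hc
      exact ⟨hje, hie, hU _ hc, h⟩
    · rw [compress, if_neg hd] at h
      exact absurd he h

open UV in
lemma exists_clique_of_compression {H : Finset (Finset (Fin n))} {s D : ℕ} (hD : 5 ≤ D)
    (hs : 2 ≤ s) (h3 : H ⊆ completeEdges n 3) {i j : Fin n} {U : Finset (Fin n)}
    (hUc : #U = 3 * s + 2) (hU : ∀ e ∈ compression {i} {j} H, e ⊆ U)
    (hν : ∀ M ⊆ H, IsMatchingFam M → #M ≤ s)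
    (hcard : (3 * s + 1).choose 3 + 3 * s * D < #H) :
    ∃ U : Finset (Fin n), #U = 3 * s + 2 ∧ ∀ e ∈ H, e ⊆ U := by
  by_cases hall : ∀ e ∈ H, e ⊆ U
  · exact ⟨U, hUc, hall⟩
  push Not at hall
  obtain ⟨e0, he0, hne⟩ := hall
  obtain h | ⟨hj0, hi0, hsub, -⟩ := mem_or_of_compression_subset hU he0
  · exact absurd h hne
  have hiU : i ∈ U := hsub (mem_insert_self _ _)
  have hjU : j ∉ U := fun h => hne fun x hx => by
    by_cases hxj : x = j
    · rwa [hxj]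
    · exact hsub (mem_insert_of_mem (mem_erase.2 ⟨hxj, hx⟩))
  have hij : i ≠ j := fun h => hjU (h ▸ hiU)
  have hc3 : ∀ e ∈ H, #e = 3 := fun e he => (mem_powersetCard.1 (h3 he)).2
  have hjW : j ∉ U.erase i := fun h => hjU (mem_of_mem_erase h)
  refine exists_clique_of_split_vertex hD hs (W := U.erase i)
    (by rw [card_erase_of_mem hiU]; omega) hij (notMem_erase _ _) hjW (fun e he => ?_)
    (fun p hp hpi hpj => ?_) hν hcard
  · obtain h | ⟨hj, hi, hs', -⟩ := mem_or_of_compression_subset hU he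
    · by_cases hie : i ∈ e
      · exact Or.inr ⟨e.erase i, mem_powersetCard.2 ⟨erase_subset_erase _ h,
          by rw [card_erase_of_mem hie, hc3 e he]⟩, Or.inl (insert_erase hie).symm⟩
      · exact Or.inl (mem_powersetCard.2 ⟨subset_erase.2 ⟨h, hie⟩, hc3 e he⟩)
    · refine Or.inr ⟨e.erase j, mem_powersetCard.2 ⟨subset_erase.2 ⟨?_, ?_⟩,
          by rw [card_erase_of_mem hj, hc3 e he]⟩, Or.inr (insert_erase hj).symm⟩
      · exact (subset_insert _ _).trans hs'
      · exact fun h => hi (mem_of_mem_erase h)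
  · have hp' := (mem_powersetCard.1 hp).1
    have hjp : j ∉ p := fun h => hjW (hp' h)
    obtain h | ⟨-, -, -, h⟩ := mem_or_of_compression_subset hU hpj
    · exact hjU (h (mem_insert_self _ _))
    · rw [erase_insert hjp] at h
      exact h hpi

open UV in
lemma matching_of_compression {H : Finset (Finset (Fin n))} {i j : Fin n} (hij : i ≠ j)
    {M : Finset (Finset (Fin n))} (hM : M ⊆ compression {i} {j} H) (hMm : IsMatchingFam M) :
    ∃ M' ⊆ H, IsMatchingFam M' ∧ #M' = #M := by
  by_cases hall : M ⊆ H
  · exact ⟨M, hall, hMm, rfl⟩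
  obtain ⟨e, heM, heH⟩ := not_subset.1 hall
  have key : ∀ f ∈ M, f ∉ H → i ∈ f ∧ j ∉ f ∧ f.map (Equiv.swap i j).toEmbedding ∈ H := by
    intro f hf hfH
    obtain h | ⟨-, b, hb, hbf⟩ := mem_compression.1 (hM hf)
    · exact absurd h.1 hfH
    by_cases hd : Disjoint {i} b ∧ {j} ≤ b
    · have hib : i ∉ b := by simpa using hd.1
      have hjb : j ∈ b := by simpa using hd.2
      rw [compress_of_disjoint_of_le hd.1 hd.2] at hbf
      subst hbf
      refine ⟨by simp [hij], by simp, ?_⟩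
      convert hb
      ext x
      simp only [mem_map_equiv, Equiv.symm_swap, Equiv.swap_apply_def, sup_eq_union, mem_sdiff,
        mem_union, mem_singleton]
      split_ifs with h1 h2
      · subst h1; tauto
      · subst h2; tauto
      · tauto
    · rw [compress, if_neg hd] at hbf
      exact absurd (hbf ▸ hb) hfH
  obtain ⟨hie, hje, heσ⟩ := key e heM heH
  refine ⟨M.image fun f => f.map (Equiv.swap i j).toEmbedding, ?_, ?_, ?_⟩
  · intro g hg
    obtain ⟨f, hf, rfl⟩ := mem_image.1 hg
    by_cases hfH : f ∈ H
    · have hfe : f ≠ e := fun h => heH (h ▸ hfH)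
      have hif : i ∉ f := fun h => disjoint_left.1 (hMm hf heM hfe) h hie
      by_cases hjf : j ∈ f
      · obtain h | h := mem_compression.1 (hM hf)
        · have h2 := h.2
          rw [compress_of_disjoint_of_le (by simpa using hif) (by simpa using hjf)] at h2
          convert h2
          ext x
          simp only [mem_map_equiv, Equiv.symm_swap, Equiv.swap_apply_def, sup_eq_union,
            mem_sdiff, mem_union, mem_singleton]
          split_ifs with h1 h2
          · subst h1; tauto
          · subst h2; tauto
          · tauto
        · exact absurd hfH h.1
      · convert hfH
        ext x
        simp only [mem_map_equiv, Equiv.symm_swap, Equiv.swap_apply_def]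
        split_ifs with h1 h2
        · subst h1; tauto
        · subst h2; tauto
        · tauto
    · exact (key f hf hfH).2.2
  · intro a ha b hb hab
    obtain ⟨a', ha', rfl⟩ := mem_image.1 (mem_coe.1 ha)
    obtain ⟨b', hb', rfl⟩ := mem_image.1 (mem_coe.1 hb)
    exact (disjoint_map _).2 (hMm ha' hb' fun h => hab (by rw [h]))
  · exact card_image_of_injective _ (map_injective _)

/-- A family is shifted if replacing an element of a member by a smaller one gives a member. -/
def IsShifted (H : Finset (Finset (Fin n))) : Prop :=
  ∀ e ∈ H, ∀ i j : Fin n, i < j → j ∈ e → i ∉ e → insert i (e.erase j) ∈ H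

open UV in
lemma sum_compression_lt {H : Finset (Finset (Fin n))} {i j : Fin n} (hij : i < j)
    {e : Finset (Fin n)} (he : e ∈ H) (hj : j ∈ e) (hi : i ∉ e)
    (hne : insert i (e.erase j) ∉ H) :
    ∑ f ∈ compression {i} {j} H, ∑ x ∈ f, (x : ℕ) < ∑ f ∈ H, ∑ x ∈ f, (x : ℕ) := by
  have hcomp : ∀ f : Finset (Fin n), j ∈ f → i ∉ f →
      compress {i} {j} f = insert i (f.erase j) := fun f hj hi => by
    rw [compress_of_disjoint_of_le (by simpa using hi) (by simpa using hj)]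
    ext x
    simp only [sup_eq_union, mem_sdiff, mem_union, mem_singleton, mem_insert, mem_erase]
    constructor
    · rintro ⟨h1 | h1, h2⟩ <;> tauto
    · rintro (h1 | h1)
      · exact ⟨Or.inr h1, h1 ▸ hij.ne⟩
      · tauto
  have hlt : ∀ f ∈ H.filter (fun f => compress {i} {j} f ∉ H),
      ∑ x ∈ compress {i} {j} f, (x : ℕ) < ∑ x ∈ f, (x : ℕ) := by
    intro f hf
    rw [mem_filter] at hf
    by_cases hd : Disjoint {i} f ∧ {j} ≤ f
    · have hif : i ∉ f := by simpa using hd.1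
      have hjf : j ∈ f := by simpa using hd.2
      rw [hcomp f hjf hif, sum_insert (fun h => hif (mem_of_mem_erase h)),
        ← add_sum_erase f _ hjf]
      have : (i : ℕ) < j := hij
      omega
    · rw [compress, if_neg hd] at hf
      exact absurd hf.1 hf.2
  have hdecomp : compression {i} {j} H = H.filter (fun f => compress {i} {j} f ∈ H) ∪
      (H.filter (fun f => compress {i} {j} f ∉ H)).image (compress {i} {j}) := by
    rw [compression, filter_image]
  rw [hdecomp, sum_union, sum_image compress_injOn, ← sum_filter_add_sum_filter_not H
    (fun f => compress {i} {j} f ∈ H)]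
  · exact Nat.add_lt_add_left (sum_lt_sum_of_nonempty
      ⟨e, mem_filter.2 ⟨he, by rwa [hcomp e hj hi]⟩⟩ hlt) _
  · rw [disjoint_left]
    intro f hf hf'
    obtain ⟨g, hg, rfl⟩ := mem_image.1 hf'
    exact (mem_filter.1 hg).2 (mem_filter.1 hf).1

open UV in
/-- To embed a family with small matching number into a clique, it suffices to treat shifted
families. -/
lemma exists_clique_of_shifted {s D : ℕ} (hD : 5 ≤ D) (hs : 2 ≤ s)
    (hshift : ∀ H ⊆ completeEdges n 3, IsShifted H → (∀ M ⊆ H, IsMatchingFam M → #M ≤ s) →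
      (3 * s + 1).choose 3 + 3 * s * D < #H →
      ∃ U : Finset (Fin n), #U = 3 * s + 2 ∧ ∀ e ∈ H, e ⊆ U)
    (H : Finset (Finset (Fin n))) (h3 : H ⊆ completeEdges n 3)
    (hν : ∀ M ⊆ H, IsMatchingFam M → #M ≤ s)
    (hcard : (3 * s + 1).choose 3 + 3 * s * D < #H) :
    ∃ U : Finset (Fin n), #U = 3 * s + 2 ∧ ∀ e ∈ H, e ⊆ U := by
  induction hm : ∑ f ∈ H, ∑ x ∈ f, (x : ℕ) using Nat.strong_induction_on generalizing H with
  | _ m ih =>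
    by_cases hH : IsShifted H
    · exact hshift H h3 hH hν hcard
    unfold IsShifted at hH
    push Not at hH
    obtain ⟨e, he, i, j, hij, hj, hi, hne⟩ := hH
    have hlt := sum_compression_lt hij he hj hi hne
    have hsz : Set.Sized 3 (H : Set (Finset (Fin n))) :=
      fun f hf => (mem_powersetCard.1 (h3 hf)).2
    have hsz' := hsz.uvCompression (u := {i}) (v := {j}) (by simp)
    obtain ⟨U, hUc, hU⟩ := ih _ (hm ▸ hlt) (compression {i} {j} H)
      (fun f hf => mem_powersetCard.2 ⟨subset_univ _, hsz' hf⟩)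
      (fun M hM hMm => by
        obtain ⟨M', h1, h2, h3⟩ := matching_of_compression hij.ne hM hMm
        exact h3 ▸ hν M' h1 h2) (by rwa [card_compression]) rfl
    exact exists_clique_of_compression hD hs h3 hUc hU hν hcard

/-- In a shifted family a member may be moved down vertex by vertex. -/
lemma IsShifted.image_mem {H : Finset (Finset (Fin n))} (hH : IsShifted H) {ι : Type*}
    [Fintype ι] [DecidableEq ι] (f g : ι → Fin n) (hf : Function.Injective f)
    (hg : Function.Injective g) (hgf : ∀ k, g k ≤ f k) (hfH : univ.image f ∈ H) :
    univ.image g ∈ H := by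
  induction hm : ∑ k, (f k : ℕ) using Nat.strong_induction_on generalizing f with
  | _ m ih =>
    by_cases hfg : f = g
    · rwa [← hfg]
    have hne : ({k | g k < f k} : Finset ι).Nonempty := by
      by_contra hne
      rw [not_nonempty_iff_eq_empty, filter_eq_empty_iff] at hne
      exact hfg (funext fun k => le_antisymm (not_lt.1 (hne (mem_univ k))) (hgf k))
    obtain ⟨k, hk, hmin⟩ := exists_min_image _ f hne
    simp only [mem_filter, mem_univ, true_and] at hk hmin
    have hgk : ∀ l, g k ≠ f l := by
      intro l hl
      by_cases hlk : l = k
      · subst hlk; exact hk.ne hl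
      · have h1 : g l < f l := lt_of_le_of_ne (hgf l) fun h => hlk (hg (h.trans hl.symm))
        exact absurd (hmin l h1) (not_le.2 (hl ▸ hk))
    have hinj : Function.Injective (Function.update f k (g k)) := by
      intro a b hab
      by_cases ha : a = k <;> by_cases hb : b = k
      · rw [ha, hb]
      · subst ha
        simp only [Function.update_self, Function.update_of_ne hb] at hab
        exact absurd hab (hgk b)
      · subst hb
        simp only [Function.update_self, Function.update_of_ne ha] at hab
        exact absurd hab.symm (hgk a)
      · simp only [Function.update_of_ne hb, Function.update_of_ne ha] at hab
        exact hf hab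
    refine ih (∑ l, (Function.update f k (g k) l : ℕ)) ?_ (Function.update f k (g k)) hinj
      (fun l => ?_) ?_ rfl
    · rw [← hm]
      refine sum_lt_sum (fun l _ => ?_) ⟨k, mem_univ _, ?_⟩
      · by_cases hl : l = k
        · subst hl; simpa using hgf l
        · simp [Function.update_of_ne hl]
      · simpa using hk
    · by_cases hl : l = k
      · subst hl; simp
      · simpa [Function.update_of_ne hl] using hgf l
    · have : univ.image (Function.update f k (g k)) =
          insert (g k) ((univ.image f).erase (f k)) := by
        ext x
        simp only [mem_image, mem_univ, true_and, mem_insert, mem_erase]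
        constructor
        · rintro ⟨l, rfl⟩
          by_cases hl : l = k
          · subst hl; simp
          · right
            rw [Function.update_of_ne hl]
            exact ⟨fun h => hl (hf h), l, rfl⟩
        · rintro (rfl | ⟨hx, l, rfl⟩)
          · exact ⟨k, by simp⟩
          · exact ⟨l, by rw [Function.update_of_ne]; rintro rfl; exact hx rfl⟩
      rw [this]
      exact hH _ hfH (g k) (f k) hk (mem_image_of_mem _ (mem_univ _)) (by
        simp only [mem_image, mem_univ, true_and, not_exists]
        exact fun l h => hgk l h.symm)

/-- In a shifted family any vertices of a member may be exchanged for smaller ones. -/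
lemma IsShifted.mem_of_exchange {H : Finset (Finset (Fin n))} (hH : IsShifted H)
    {e e' : Finset (Fin n)} (he : e ∈ H) (hc : #e' = #e)
    (hlt : ∀ y ∈ e' \ e, ∀ x ∈ e \ e', y < x) : e' ∈ H := by
  induction hm : #(e \ e') generalizing e with
  | zero =>
    have hsub : e ⊆ e' := sdiff_eq_empty_iff_subset.1 (card_eq_zero.1 hm)
    rwa [← eq_of_subset_of_card_le hsub hc.le]
  | succ m ih =>
    obtain ⟨x, hx⟩ := card_pos.1 (show 0 < #(e \ e') by omega)
    have hcc : #(e' \ e) = #(e \ e') := by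
      have h1 := card_sdiff_add_card_inter e e'
      have h2 := card_sdiff_add_card_inter e' e
      rw [inter_comm] at h2
      omega
    obtain ⟨y, hy⟩ := card_pos.1 (show 0 < #(e' \ e) by omega)
    have hx' := mem_sdiff.1 hx
    have hy' := mem_sdiff.1 hy
    have hnew := hH e he y x (hlt y hy x hx) hx'.1 hy'.2
    have hsd : insert y (e.erase x) \ e' = (e \ e').erase x := by
      ext z
      simp only [mem_sdiff, mem_insert, mem_erase]
      constructor
      · rintro ⟨rfl | h1, h2⟩
        · exact absurd hy'.1 h2
        · exact ⟨h1.1, h1.2, h2⟩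
      · rintro ⟨h1, h2, h3⟩
        exact ⟨Or.inr ⟨h1, h2⟩, h3⟩
    refine ih hnew ?_ ?_ ?_
    · rw [card_insert_of_notMem (fun h => hy'.2 (mem_of_mem_erase h)), card_erase_of_mem hx'.1]
      have := card_pos.2 ⟨x, hx'.1⟩
      omega
    · intro z hz w hw
      rw [hsd] at hw
      refine hlt z ?_ w (mem_of_mem_erase hw)
      simp only [mem_sdiff, mem_insert, mem_erase, not_or, not_and] at hz ⊢
      exact ⟨hz.1, fun h => hx'.2 (by
        by_cases hzx : z = x
        · exact hzx ▸ hz.1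
        · exact absurd h (hz.2.2 hzx))⟩
    · rw [hsd, card_erase_of_mem hx, hm]; rfl

end Shift

section Completion

variable {α : Type*} [DecidableEq α]

lemma IsMatchingFam.card_biUnion {M : Finset (Finset α)} (hM : IsMatchingFam M)
    (h3 : ∀ e ∈ M, #e = 3) : #(M.biUnion id) = 3 * #M := by
  have h := Finset.card_biUnion (s := M) (t := id) fun x hx y hy h => hM hx hy h
  rw [h]
  simp only [id]
  rw [sum_congr rfl h3, sum_const, smul_eq_mul, mul_comm]

/-- If all vertices outside a clique `A` either are already covered or have many link pairs in `A`,
a matching extends to a perfect one. -/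
lemma exists_perfect_matching_of_cover {m u : ℕ} {H M : Finset (Finset α)} {V A : Finset α}
    (hV : #V = 3 * m) (hA : ∀ e ∈ powersetCard 3 A, e ∈ H) (hMH : M ⊆ H) (hM : IsMatchingFam M)
    (hMV : M ⊆ powersetCard 3 V) (hAV : A ⊆ V)
    (hgood : ∀ z ∈ V, z ∉ A → z ∉ M.biUnion id →
      u * #A < #{P ∈ powersetCard 2 A | insert z P ∈ H})
    (hu : #(A ∩ M.biUnion id) + 2 * #((V \ A) \ M.biUnion id) ≤ u) :
    ∃ M' ⊆ H, IsMatchingFam M' ∧ #M' = m := by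
  have hM3 : ∀ e ∈ M, #e = 3 := fun e he => (mem_powersetCard.1 (hMV he)).2
  have hMsub : M.biUnion id ⊆ V := biUnion_subset.2 fun e he => (mem_powersetCard.1 (hMV he)).1
  induction hk : #((V \ A) \ M.biUnion id) generalizing M with
  | zero =>
    have hR : V \ M.biUnion id ⊆ A := by
      intro x hx
      by_contra hxA
      have : x ∈ (V \ A) \ M.biUnion id := by
        simp only [mem_sdiff] at hx ⊢; exact ⟨⟨hx.1, hxA⟩, hx.2⟩
      rw [card_eq_zero.1 hk] at this
      simp at this
    have hMc := hM.card_biUnion hM3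
    have hle := card_le_card hMsub
    obtain ⟨M', h1, h2, h3, -⟩ := exists_partition_few_missing (m - #M) (V \ M.biUnion id)
      (by rw [card_sdiff_of_subset hMsub]; omega) ∅ (empty_subset _)
    have hdis : ∀ e ∈ M, ∀ f ∈ M', Disjoint e f := fun e he f hf =>
      disjoint_of_subset_left (subset_biUnion_of_mem id he)
        (disjoint_of_subset_right (mem_powersetCard.1 (h1 hf)).1 disjoint_sdiff)
    refine ⟨M ∪ M', union_subset hMH fun e he => hA e
      (powersetCard_mono hR (h1 he)), ?_, ?_⟩
    · intro e he f hf hef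
      simp only [coe_union, Set.mem_union, mem_coe] at he hf
      rcases he with he | he <;> rcases hf with hf | hf
      · exact hM he hf hef
      · exact hdis e he f hf
      · exact (hdis f hf e he).symm
      · exact h2 he hf hef
    · rw [card_union_of_disjoint, h3]
      · omega
      · rw [disjoint_left]
        intro e he he'
        have := hdis e he e he'
        rw [disjoint_self, bot_eq_empty] at this
        have h0 := hM3 e he
        rw [this] at h0
        simp at h0
  | succ k ih =>
    obtain ⟨z, hz⟩ := card_pos.1 (show 0 < #((V \ A) \ M.biUnion id) by omega)
    have hz' : (z ∈ V ∧ z ∉ A) ∧ z ∉ M.biUnion id := by simpa only [mem_sdiff] using hz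
    have hg := hgood z hz'.1.1 hz'.1.2 hz'.2
    obtain ⟨P, hP, hPd⟩ : ∃ P ∈ powersetCard 2 A, insert z P ∈ H ∧
        Disjoint (A ∩ M.biUnion id) P := by
      by_contra! hcon
      have h1 : #{P ∈ powersetCard 2 A | insert z P ∈ H} ≤ #(A ∩ M.biUnion id) * #A := by
        refine (card_le_card fun P hP => ?_).trans (card_pairs_meeting_le _ _)
        rw [mem_filter] at hP ⊢
        exact ⟨hP.1, hcon P hP.1 hP.2⟩
      have h2 : #(A ∩ M.biUnion id) * #A ≤ u * #A := Nat.mul_le_mul_right _ (by omega)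
      omega
    have hP' := mem_powersetCard.1 hP
    have hzP : z ∉ P := fun h => hz'.1.2 (hP'.1 h)
    have hd : Disjoint (insert z P) (M.biUnion id) := by
      rw [disjoint_insert_left]
      refine ⟨hz'.2, ?_⟩
      rw [disjoint_left]
      intro x hx hx'
      exact disjoint_left.1 hPd.2 (mem_inter.2 ⟨hP'.1 hx, hx'⟩) hx
    have hbi : (insert (insert z P) M).biUnion id = insert z P ∪ M.biUnion id := by
      rw [biUnion_insert]; rfl
    have hzPV : insert z P ⊆ V := insert_subset hz'.1.1 (hP'.1.trans hAV)
    have hsd : (V \ A) \ (insert z P ∪ M.biUnion id) = ((V \ A) \ M.biUnion id).erase z := by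
      ext x
      simp only [mem_sdiff, mem_union, mem_insert, mem_erase, not_or]
      constructor
      · tauto
      · rintro ⟨h1, ⟨h2, h3⟩, h4⟩
        exact ⟨⟨h2, h3⟩, ⟨h1, fun h => h3 (hP'.1 h)⟩, h4⟩
    have hcard : #((V \ A) \ (insert z P ∪ M.biUnion id)) = k := by
      rw [hsd, card_erase_of_mem hz, hk]; rfl
    have hint : #(A ∩ (insert z P ∪ M.biUnion id)) ≤ 2 + #(A ∩ M.biUnion id) := by
      rw [← hP'.2]
      refine (card_le_card fun x hx => ?_).trans (card_union_le _ _)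
      simp only [mem_inter, mem_union, mem_insert] at hx ⊢
      rcases hx with ⟨h1, (rfl | h2) | h2⟩
      · exact absurd h1 hz'.1.2
      · exact Or.inl h2
      · exact Or.inr ⟨h1, h2⟩
    refine ih (M := insert (insert z P) M) (insert_subset hPd.1 hMH) (hM.insert hd)
      (insert_subset (mem_powersetCard.2 ⟨hzPV, ?_⟩) hMV) ?_ ?_ ?_ ?_ ?_
    · rw [card_insert_of_notMem hzP, hP'.2]
    · intro y hyV hyA hy
      rw [hbi, notMem_union] at hy
      exact hgood y hyV hyA hy.2
    · rw [hbi, hcard]; omega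
    · intro e he
      rcases mem_insert.1 he with rfl | he
      · rw [card_insert_of_notMem hzP, hP'.2]
      · exact hM3 e he
    · rw [hbi]; exact union_subset hzPV hMsub
    · rw [hbi, hcard]

/-- Disjoint sets of size at most three can be completed to disjoint triples which use up a
prescribed set of new vertices. -/
lemma exists_triples_extending (S : Finset (Finset α)) (hS : IsMatchingFam S)
    (h2 : ∀ Q ∈ S, #Q ≤ 3) (Y : Finset α)
    (hY : Disjoint (S.biUnion id) Y) (hc : #Y = ∑ Q ∈ S, (3 - #Q)) :
    ∃ M : Finset (Finset α), IsMatchingFam M ∧ M.biUnion id = S.biUnion id ∪ Y ∧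
      ∀ e ∈ M, #e = 3 ∧ ∃ Q ∈ S, Q ⊆ e := by
  induction S using Finset.induction_on generalizing Y with
  | empty =>
    refine ⟨∅, by simp [IsMatchingFam], ?_, by simp⟩
    simp only [sum_empty, card_eq_zero] at hc
    simp [hc]
  | insert Q S hQS ih =>
    rw [sum_insert hQS] at hc
    rw [biUnion_insert, disjoint_union_left] at hY
    obtain ⟨Y1, hY1, hY1c⟩ := exists_subset_card_eq (show 3 - #Q ≤ #Y by omega)
    obtain ⟨M, hM1, hM2, hM3⟩ := ih (fun a ha b hb h => hS (by simp [mem_coe.1 ha])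
      (by simp [mem_coe.1 hb]) h) (fun P hP => h2 P (mem_insert_of_mem hP)) (Y \ Y1)
      (disjoint_of_subset_right sdiff_subset hY.2) (by rw [card_sdiff_of_subset hY1]; omega)
    have hQd : Disjoint Q (S.biUnion id) := by
      rw [disjoint_biUnion_right]
      intro P hP
      exact hS (by simp) (by simp [hP]) (fun h => hQS (h ▸ hP))
    have hd : Disjoint (Q ∪ Y1) (M.biUnion id) := by
      rw [hM2, disjoint_union_left, disjoint_union_right, disjoint_union_right]
      exact ⟨⟨hQd, disjoint_of_subset_right sdiff_subset hY.1⟩,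
        (disjoint_of_subset_right hY1 hY.2).symm, disjoint_sdiff⟩
    refine ⟨insert (Q ∪ Y1) M, hM1.insert hd, ?_, ?_⟩
    · rw [biUnion_insert, biUnion_insert, hM2]
      ext x
      have := @hY1 x
      simp only [id, mem_union, mem_sdiff]
      tauto
    · intro e he
      rcases mem_insert.1 he with rfl | he
      · refine ⟨?_, Q, mem_insert_self _ _, subset_union_left⟩
        have := h2 Q (mem_insert_self _ _)
        rw [card_union_of_disjoint (s := Q) (t := Y1) (disjoint_of_subset_right hY1 hY.1), hY1c]
        omega
      · obtain ⟨h3, P, hP, hPe⟩ := hM3 e he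
        exact ⟨h3, P, mem_insert_of_mem hP, hPe⟩

lemma card_le_three_or_star (F : Finset (Finset α)) (h2 : ∀ Q ∈ F, #Q = 2)
    (hint : ∀ P ∈ F, ∀ Q ∈ F, ¬Disjoint P Q) (hne : F.Nonempty) :
    #F ≤ 3 ∨ ∃ o, ∀ Q ∈ F, o ∈ Q := by
  by_contra! hcon
  obtain ⟨hF, hstar⟩ := hcon
  obtain ⟨P, hP⟩ := hne
  obtain ⟨a, b, hab, rfl⟩ := card_eq_two.1 (h2 P hP)
  obtain ⟨Q, hQ, hbQ⟩ := hstar b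
  have haQ : a ∈ Q := by
    have := hint _ hP _ hQ
    simp only [disjoint_insert_left, disjoint_singleton_left] at this
    tauto
  obtain ⟨c, hc⟩ := card_eq_one.1 (show #(Q.erase a) = 1 by rw [card_erase_of_mem haQ, h2 Q hQ])
  have hQac : Q = {a, c} := by rw [← insert_erase haQ, hc]
  have hca : c ≠ a := (mem_erase.1 (hc ▸ mem_singleton_self c)).1
  subst hQac
  have hcb : c ≠ b := fun h => hbQ (by simp [h])
  obtain ⟨R, hR, haR⟩ := hstar a
  have hbR : b ∈ R := by
    have := hint _ hP _ hR
    simp only [disjoint_insert_left, disjoint_singleton_left] at this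
    tauto
  have hcR : c ∈ R := by
    have := hint _ hQ _ hR
    simp only [disjoint_insert_left, disjoint_singleton_left] at this
    tauto
  have heq : ∀ T ∈ F, ∀ x y, x ≠ y → x ∈ T → y ∈ T → T = {x, y} := fun T hT x y hxy hx hy =>
    (eq_of_subset_of_card_le (by simp [insert_subset_iff, hx, hy])
      (by rw [h2 T hT, card_pair hxy])).symm
  have hsub : F ⊆ {{a, b}, {a, c}, {b, c}} := by
    intro T hT
    have i1 := hint _ hP _ hT
    have i2 := hint _ hQ _ hT
    have i3 := hint _ hR _ hT
    rw [heq R hR b c hcb.symm hbR hcR] at i3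
    simp only [disjoint_insert_left, disjoint_singleton_left] at i1 i2 i3
    simp only [mem_insert, mem_singleton]
    by_cases h1 : a ∈ T
    · by_cases h2 : b ∈ T
      · exact Or.inl (heq T hT a b hab h1 h2)
      · exact Or.inr (Or.inl (heq T hT a c hca.symm h1 (by tauto)))
    · exact Or.inr (Or.inr (heq T hT b c hcb.symm (by tauto) (by tauto)))
  have := (card_le_card hsub).trans card_le_three
  omega

lemma card_cross_intersecting_le {W : Finset α} {s D : ℕ} (hW : #W = 3 * s + 1) (hD : 2 ≤ D)
    (hs : 5 ≤ s) {F G : Finset (Finset α)} (hF : F ⊆ powersetCard 2 W)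
    (hG : G ⊆ powersetCard 2 W) (hne : F.Nonempty)
    (hint : ∀ P ∈ F, ∀ Q ∈ F, ¬Disjoint P Q) (hcross : ∀ P ∈ F, ∀ Q ∈ G, ¬Disjoint P Q) :
    #G + #F * D ≤ 3 * s * (D + 1) := by
  by_cases h3 : #F ≤ 3
  · obtain ⟨P, hP⟩ := hne
    have h1 : #G ≤ 2 * #W := by
      rw [← (mem_powersetCard.1 (hF hP)).2]
      refine (card_le_card fun q hq => ?_).trans (card_pairs_meeting_le P W)
      exact mem_filter.2 ⟨hG hq, hcross P hP q hq⟩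
    rw [hW] at h1
    nlinarith
  · obtain h | ⟨o, ho⟩ := card_le_three_or_star F (fun Q hQ => (mem_powersetCard.1 (hF hQ)).2)
      hint hne
    · exact absurd h h3
    have hstar : ∀ E ⊆ powersetCard 2 W, (∀ Q ∈ E, o ∈ Q) → o ∈ W → #E ≤ 3 * s := by
      intro E hE hoE hoW
      have : E ⊆ (W.erase o).image fun x => {o, x} := by
        intro Q hQ
        have hQ' := mem_powersetCard.1 (hE hQ)
        have hoQ := hoE Q hQ
        obtain ⟨x, hx⟩ := card_eq_one.1
          (show #(Q.erase o) = 1 by rw [card_erase_of_mem hoQ, hQ'.2])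
        have hxQ := mem_erase.1 (hx ▸ mem_singleton_self x)
        exact mem_image.2 ⟨x, mem_erase.2 ⟨hxQ.1, hQ'.1 hxQ.2⟩, by rw [← insert_erase hoQ, hx]⟩
      have := (card_le_card this).trans card_image_le
      rwa [card_erase_of_mem hoW, hW] at this
    have hoG : ∀ Q ∈ G, o ∈ Q := by
      intro Q hQ
      by_contra hoQ
      have hsub : F ⊆ Q.image fun x => {o, x} := by
        intro P hP
        have hoP := ho P hP
        obtain ⟨x, hxP, hxQ⟩ := not_disjoint_iff.1 (hcross P hP Q hQ)
        have hxo : o ≠ x := fun h => hoQ (h ▸ hxQ)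
        refine mem_image.2 ⟨x, hxQ, eq_of_subset_of_card_le
          (by simp [insert_subset_iff, hoP, hxP]) ?_⟩
        rw [(mem_powersetCard.1 (hF hP)).2, card_pair hxo]
      have := (card_le_card hsub).trans card_image_le
      rw [(mem_powersetCard.1 (hG hQ)).2] at this
      omega
    obtain ⟨P, hP⟩ := hne
    have hoW : o ∈ W := (mem_powersetCard.1 (hF hP)).1 (ho P hP)
    have h1 := hstar F hF ho hoW
    have h2 := hstar G hG hoG hoW
    nlinarith

end Completion

section NearClique

variable {α : Type*} [DecidableEq α]

/-- Vertices outside `A` with few link pairs inside `A`. -/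
def poorVertices (H : Finset (Finset α)) (U A : Finset α) (u : ℕ) : Finset α :=
  {z ∈ U \ A | #{P ∈ powersetCard 2 A | insert z P ∈ H} ≤ u * #A}

/-- The traces on `U` of the members which are not contained in `U`. -/
def outerTraces (H : Finset (Finset α)) (U : Finset α) : Finset (Finset α) :=
  {e ∈ H | ¬e ⊆ U}.image (· ∩ U)

lemma not_covers_poorVertices {s u : ℕ} {H M : Finset (Finset α)} {U A : Finset α} {v : α}
    (hU : #U = 3 * s + 2) (hv : v ∉ U) (hAU : A ⊆ U) (hA : ∀ e ∈ powersetCard 3 A, e ∈ H)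
    (hν : ∀ M ⊆ H, IsMatchingFam M → #M ≤ s) (hMH : M ⊆ H) (hM : IsMatchingFam M)
    (hMV : M ⊆ powersetCard 3 (insert v U)) (hvM : v ∈ M.biUnion id)
    (hB : poorVertices H U A u ⊆ M.biUnion id)
    (hu : #(M.biUnion id) + 2 * #(U \ A) ≤ u) : False := by
  suffices h : ∃ M' ⊆ H, IsMatchingFam M' ∧ #M' = s + 1 by
    obtain ⟨M', h1, h2, h3⟩ := h
    have := hν M' h1 h2
    omega
  refine exists_perfect_matching_of_cover (m := s + 1) (u := u)
    (by rw [card_insert_of_notMem hv, hU]; ring) hA hMH hM hMV (hAU.trans (subset_insert _ _))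
    (fun z hz hzA hzM => ?_) ?_
  · by_contra hcon
    have hzU : z ∈ U := by
      rcases mem_insert.1 hz with rfl | hz
      · exact absurd hvM hzM
      · exact hz
    exact hzM (hB (mem_filter.2 ⟨mem_sdiff.2 ⟨hzU, hzA⟩, not_lt.1 hcon⟩))
  · have h1 : #(A ∩ M.biUnion id) ≤ #(M.biUnion id) := card_le_card inter_subset_right
    have h2 : #((insert v U \ A) \ M.biUnion id) ≤ #(U \ A) := by
      refine card_le_card fun x hx => ?_
      simp only [mem_sdiff, mem_insert] at hx ⊢
      rcases hx with ⟨⟨rfl | h, h'⟩, h''⟩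
      · exact absurd hvM h''
      · exact ⟨h, h'⟩
    omega

lemma not_disjoint_traces {s p : ℕ} {H S : Finset (Finset α)} {U A : Finset α} {v : α}
    (hU : #U = 3 * s + 2) (hv : v ∉ U) (hAU : A ⊆ U) (hA : ∀ e ∈ powersetCard 3 A, e ∈ H)
    (hp : #(U \ A) = p) (hps : p ≤ s)
    (hν : ∀ M ⊆ H, IsMatchingFam M → #M ≤ s)
    (hpush : ∀ e ∈ H, ¬e ⊆ U → ∀ e' ∈ powersetCard 3 (insert v U), e ∩ U ⊆ e' → e' ∈ H)
    (hST : S ⊆ outerTraces H U) (hS2 : ∀ Q ∈ S, #Q ≤ 2) (hS : IsMatchingFam S)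
    (hcov : #(insert v (poorVertices H U A (6 * (p + 1))) \ S.biUnion id) ≤ ∑ Q ∈ S, (3 - #Q))
    (hSp : #S ≤ p + 1) : False := by
  have hSU : S.biUnion id ⊆ U := biUnion_subset.2 fun Q hQ => by
    obtain ⟨e, -, rfl⟩ := mem_image.1 (hST hQ)
    exact inter_subset_right
  have hsum : #(S.biUnion id) + ∑ Q ∈ S, (3 - #Q) = 3 * #S := by
    have h := Finset.card_biUnion (s := S) (t := id) fun x hx y hy h => hS hx hy h
    rw [h, ← sum_add_distrib]
    simp only [id]
    rw [sum_congr rfl (g := fun _ => 3) (fun Q hQ => by have := hS2 Q hQ; omega), sum_const,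
      smul_eq_mul, mul_comm]
  have hBU : insert v (poorVertices H U A (6 * (p + 1))) ⊆ insert v U :=
    insert_subset_insert _ ((filter_subset _ _).trans sdiff_subset)
  obtain ⟨Y, hY1, hY2, hYc⟩ := exists_subsuperset_card_eq
    (sdiff_subset_sdiff hBU (subset_refl (S.biUnion id))) hcov (by
      rw [card_sdiff_of_subset (hSU.trans (subset_insert _ _)), card_insert_of_notMem hv]
      omega)
  obtain ⟨M, hM1, hM2, hM3⟩ := exists_triples_extending S hS
    (fun Q hQ => (hS2 Q hQ).trans (by norm_num)) Y
    (disjoint_of_subset_right hY2 disjoint_sdiff) hYc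
  have hMV : M ⊆ powersetCard 3 (insert v U) := fun e he => mem_powersetCard.2
    ⟨(subset_biUnion_of_mem id he).trans (hM2 ▸ union_subset (hSU.trans (subset_insert _ _))
      (hY2.trans sdiff_subset)), (hM3 e he).1⟩
  have hcov' : insert v (poorVertices H U A (6 * (p + 1))) ⊆ M.biUnion id := by
    rw [hM2]
    intro x hx
    by_cases hxS : x ∈ S.biUnion id
    · exact mem_union_left _ hxS
    · exact mem_union_right _ (hY1 (mem_sdiff.2 ⟨hx, hxS⟩))
  refine not_covers_poorVertices (u := 6 * (p + 1)) hU hv hAU hA hν (fun e he => ?_) hM1 hMV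
    (hcov' (mem_insert_self _ _)) ((subset_insert _ _).trans hcov') ?_
  · obtain ⟨h3, Q, hQ, hQe⟩ := hM3 e he
    obtain ⟨f, hf, rfl⟩ := mem_image.1 (hST hQ)
    rw [mem_filter] at hf
    exact hpush f hf.1 hf.2 e (hMV he) hQe
  · rw [hM2]
    have := card_union_le (S.biUnion id) Y
    omega

lemma card_members_with_trace_le [Fintype α] {H : Finset (Finset α)} {U : Finset α} (k l : ℕ)
    (h3 : ∀ e ∈ H, #e = k + l) :
    #{e ∈ H | ¬e ⊆ U ∧ #(e ∩ U) = k} ≤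
      #{Q ∈ outerTraces H U | #Q = k} * (#(univ \ U)).choose l := by
  rw [← card_powersetCard, ← card_product]
  refine card_le_card_of_injOn (fun e => (e ∩ U, e \ U)) (fun e he => ?_) ?_
  · simp only [coe_filter, Set.mem_ofPred_eq] at he
    simp only [coe_product, Set.mem_prod, mem_coe, mem_filter, mem_powersetCard]
    refine ⟨⟨mem_image_of_mem _ (mem_filter.2 ⟨he.1, he.2.1⟩), he.2.2⟩,
      sdiff_subset_sdiff (subset_univ _) subset_rfl, ?_⟩
    have := card_sdiff_add_card_inter e U
    have := h3 e he.1
    omega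
  · intro e _ f _ hef
    simp only [Prod.mk.injEq] at hef
    rw [← sdiff_union_inter e U, ← sdiff_union_inter f U, hef.1, hef.2]

lemma card_le_of_traces [Fintype α] {H : Finset (Finset α)} {U : Finset α}
    (h3 : ∀ e ∈ H, #e = 3) (h0 : ∅ ∉ outerTraces H U) :
    #H ≤ #{e ∈ H | e ⊆ U} + #{Q ∈ outerTraces H U | #Q = 2} * #(univ \ U) +
      #{Q ∈ outerTraces H U | #Q = 1} * (#(univ \ U)).choose 2 := by
  have h1 := card_members_with_trace_le (U := U) 2 1 h3
  have h2 := card_members_with_trace_le (U := U) 1 2 h3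
  rw [Nat.choose_one_right] at h1
  have hsub : H ⊆ {e ∈ H | e ⊆ U} ∪ ({e ∈ H | ¬e ⊆ U ∧ #(e ∩ U) = 2} ∪
      {e ∈ H | ¬e ⊆ U ∧ #(e ∩ U) = 1}) := by
    intro e he
    simp only [mem_union, mem_filter]
    by_cases heU : e ⊆ U
    · exact Or.inl ⟨he, heU⟩
    · right
      have hlt : #(e ∩ U) < #e := card_lt_card
        ⟨inter_subset_left, fun h => heU (h.trans inter_subset_right)⟩
      have hpos : #(e ∩ U) ≠ 0 := fun h => h0 (by
        rw [← card_eq_zero.1 h]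
        exact mem_image_of_mem _ (mem_filter.2 ⟨he, heU⟩))
      have := h3 e he
      have : #(e ∩ U) = 2 ∨ #(e ∩ U) = 1 := by omega
      tauto
  have := card_le_card hsub
  have := card_union_le {e ∈ H | e ⊆ U} ({e ∈ H | ¬e ⊆ U ∧ #(e ∩ U) = 2} ∪
      {e ∈ H | ¬e ⊆ U ∧ #(e ∩ U) = 1})
  have := card_union_le {e ∈ H | ¬e ⊆ U ∧ #(e ∩ U) = 2} {e ∈ H | ¬e ⊆ U ∧ #(e ∩ U) = 1}
  omega

open scoped Classical in
lemma exists_maximal_matching (F : Finset (Finset α)) (hF : ∀ Q ∈ F, Q.Nonempty) :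
    ∃ S ⊆ F, IsMatchingFam S ∧ ∀ Q ∈ F, ¬Disjoint (S.biUnion id) Q := by
  obtain ⟨S, hS, hmax⟩ := exists_max_image ({S ∈ F.powerset | IsMatchingFam S}) card
    ⟨∅, mem_filter.2 ⟨empty_mem_powerset _, by simp [IsMatchingFam]⟩⟩
  rw [mem_filter, mem_powerset] at hS
  refine ⟨S, hS.1, hS.2, fun Q hQ hd => ?_⟩
  have := hmax (insert Q S) (mem_filter.2 ⟨mem_powerset.2 (insert_subset hQ hS.1),
    hS.2.insert hd.symm⟩)
  rw [card_insert_of_notMem (notMem_of_disjoint_biUnion hd.symm (hF Q hQ))] at this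
  omega

lemma IsMatchingFam.mono {S T : Finset (Finset α)} (hT : IsMatchingFam T) (h : S ⊆ T) :
    IsMatchingFam S := Set.Pairwise.mono (coe_subset.2 h) hT

lemma card_inside_add_le {H : Finset (Finset α)} {U A B : Finset α} {m : ℕ} (hAU : A ⊆ U)
    (hB : B ⊆ U \ A) (hm : ∀ z ∈ B, m ≤ #{P ∈ powersetCard 2 A | insert z P ∉ H})
    (h3 : ∀ e ∈ H, #e = 3) : #{e ∈ H | e ⊆ U} + #B * m ≤ (#U).choose 3 := by
  have hle : #B * m ≤ #(powersetCard 3 U \ {e ∈ H | e ⊆ U}) := by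
    refine (card_nsmul_le_sum B _ m hm).trans ?_
    rw [← card_sigma]
    refine card_le_card_of_injOn (fun x => insert x.1 x.2) (fun x hx => ?_) ?_
    · simp only [coe_sigma, Set.mem_sigma_iff, mem_coe, mem_filter, mem_powersetCard] at hx
      have hz := mem_sdiff.1 (hB hx.1)
      simp only [mem_coe, mem_sdiff, mem_powersetCard, mem_filter]
      refine ⟨⟨insert_subset hz.1 (hx.2.1.1.trans hAU), ?_⟩, fun h => hx.2.2 h.1⟩
      rw [card_insert_of_notMem (fun h => hz.2 (hx.2.1.1 h)), hx.2.1.2]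
    · rintro ⟨z, P⟩ hx ⟨w, Q⟩ hy hxy
      simp only [coe_sigma, Set.mem_sigma_iff, mem_coe, mem_filter, mem_powersetCard] at hx hy hxy
      have hz := mem_sdiff.1 (hB hx.1)
      have hw := mem_sdiff.1 (hB hy.1)
      have hzQ : z ∉ Q := fun h => hz.2 (hy.2.1.1 h)
      have hzP : z ∉ P := fun h => hz.2 (hx.2.1.1 h)
      have hzw : z = w := by
        have : z ∈ insert w Q := hxy ▸ mem_insert_self _ _
        rcases mem_insert.1 this with h | h
        · exact h
        · exact absurd h hzQ
      subst hzw
      have : P = Q := by rw [← erase_insert hzP, hxy, erase_insert hzQ]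
      rw [this]
  have hsub : {e ∈ H | e ⊆ U} ⊆ powersetCard 3 U := fun e he => by
    rw [mem_filter] at he
    exact mem_powersetCard.2 ⟨he.2, h3 e he.1⟩
  have := card_sdiff_add_card_eq_card hsub
  rw [card_powersetCard] at this
  omega

lemma card_inside_le_of_link {H : Finset (Finset α)} {U : Finset α} {z : α} (hz : z ∈ U)
    (h3 : ∀ e ∈ H, #e = 3) :
    #{e ∈ H | e ⊆ U} ≤ (#U - 1).choose 3 + #{P ∈ powersetCard 2 (U.erase z) | insert z P ∈ H} := by
  rw [← card_erase_of_mem hz, ← card_powersetCard, ← card_insert_pairs (U.erase z) z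
    (notMem_erase _ _) _ (filter_subset _ _)]
  refine (card_le_card fun e he => ?_).trans (card_union_le _ _)
  rw [mem_filter] at he
  rw [mem_union]
  by_cases hze : z ∈ e
  · right
    refine mem_image.2 ⟨e.erase z, mem_filter.2 ⟨mem_powersetCard.2
      ⟨erase_subset_erase _ he.2, ?_⟩, by rw [insert_erase hze]; exact he.1⟩, insert_erase hze⟩
    rw [card_erase_of_mem hze, h3 e he.1]
  · exact Or.inl (mem_powersetCard.2 ⟨subset_erase.2 ⟨he.2, hze⟩, h3 e he.1⟩)

end NearClique

section NearClique

variable {α : Type*} [DecidableEq α]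

lemma deficiency_bounds {s p D L : ℕ} (hs : 100000 ≤ s) (hp : 2000 * p ≤ 3 * s)
    (hD : 13 * D ≤ 6 * s) (hL : L + p = 3 * s + 2) :
    2 * (3 * s + 2) * D + D.choose 2 + 6 * (p + 1) * L ≤ L.choose 2 ∧
    (3 * s + 1).choose 2 + 2 * (2 * (3 * s + 2) * D + D.choose 2 + 6 * (p + 1) * L) ≤
      2 * L.choose 2 + 3 * s * (D + 1) := by
  have h1 : ((L.choose 2 : ℕ) : ℝ) = L * (L - 1) / 2 := Nat.cast_choose_two ℝ L
  have h2 : ((D.choose 2 : ℕ) : ℝ) = D * (D - 1) / 2 := Nat.cast_choose_two ℝ D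
  have h3 : (((3 * s + 1).choose 2 : ℕ) : ℝ) = (3 * s + 1) * (3 * s) / 2 := by
    rw [Nat.cast_choose_two]; push_cast; ring
  have hs' : (100000 : ℝ) ≤ s := by exact_mod_cast hs
  have hp' : 2000 * (p : ℝ) ≤ 3 * s := by exact_mod_cast hp
  have hD' : 13 * (D : ℝ) ≤ 6 * s := by exact_mod_cast hD
  have hL' : (L : ℝ) = 3 * s + 2 - p := by
    have : (L : ℝ) + p = 3 * s + 2 := by exact_mod_cast hL
    linarith
  have hp0 : (0 : ℝ) ≤ p := p.cast_nonneg
  have hD0 : (0 : ℝ) ≤ D := D.cast_nonneg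
  have e1 : 8.991 * (s : ℝ) ^ 2 ≤ L * (L - 1) := by
    have : (2.9985 * (s : ℝ)) * (2.9985 * s) ≤ L * (L - 1) :=
      mul_le_mul (by linarith) (by linarith) (by linarith) (by linarith)
    nlinarith
  have e2 : 12 * ((p : ℝ) + 1) * L ≤ 0.0546 * (s : ℝ) ^ 2 := by
    have : ((p : ℝ) + 1) * L ≤ (0.00151 * s) * (3.0001 * s) :=
      mul_le_mul (by linarith) (by linarith) (by linarith) (by linarith)
    nlinarith
  have e3 : (D : ℝ) ^ 2 ≤ 0.21303 * (s : ℝ) ^ 2 := by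
    have : (D : ℝ) ^ 2 ≤ (6 / 13 * s) ^ 2 := pow_le_pow_left₀ hD0 (by linarith) 2
    nlinarith
  have e4 : (s : ℝ) * D ≤ 6 / 13 * (s : ℝ) ^ 2 := by nlinarith
  have e5 : 100000 * (s : ℝ) ≤ (s : ℝ) ^ 2 := by nlinarith
  constructor
  · have : ((2 * (3 * s + 2) * D + D.choose 2 + 6 * (p + 1) * L : ℕ) : ℝ) ≤ (L.choose 2 : ℕ) := by
      push_cast
      rw [h1, h2]
      linarith
    exact_mod_cast this
  · have : (((3 * s + 1).choose 2 + 2 * (2 * (3 * s + 2) * D + D.choose 2 +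
        6 * (p + 1) * L) : ℕ) : ℝ) ≤ ((2 * L.choose 2 + 3 * s * (D + 1) : ℕ) : ℝ) := by
      push_cast
      rw [h1, h2, h3]
      linarith
    exact_mod_cast this

/-- If all triples of an almost full subset of `U` are members, then no member leaves `U`. -/
lemma subset_of_near_clique [Fintype α] {s p D : ℕ} {H : Finset (Finset α)} {U A : Finset α}
    {v : α} (hU : #U = 3 * s + 2) (hv : v ∉ U) (hAU : A ⊆ U)
    (hA : ∀ e ∈ powersetCard 3 A, e ∈ H) (hp : #(U \ A) = p)
    (hDc : #(univ \ U) = D) (hD2 : 2 ≤ D) (hD : 13 * D ≤ 6 * s) (hps : 2000 * p ≤ 3 * s)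
    (hs : 100000 ≤ s) (h3 : ∀ e ∈ H, #e = 3)
    (hν : ∀ M ⊆ H, IsMatchingFam M → #M ≤ s)
    (hpush : ∀ e ∈ H, ¬e ⊆ U → ∀ e' ∈ powersetCard 3 (insert v U), e ∩ U ⊆ e' → e' ∈ H)
    (hcard : (3 * s + 1).choose 3 + 3 * s * (D + 1) < #H) :
    ∀ e ∈ H, e ⊆ U := by
  by_cases hT : outerTraces H U = ∅
  · intro e he
    by_contra hne
    have : e ∩ U ∈ outerTraces H U := mem_image_of_mem _ (mem_filter.2 ⟨he, hne⟩)
    rw [hT] at this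
    simp at this
  exfalso
  have hT2 : ∀ Q ∈ outerTraces H U, #Q ≤ 2 := by
    intro Q hQ
    obtain ⟨e, he, rfl⟩ := mem_image.1 hQ
    rw [mem_filter] at he
    have hlt : #(e ∩ U) < #e := card_lt_card
      ⟨inter_subset_left, fun h => he.2 (h.trans inter_subset_right)⟩
    have := h3 e he.1
    omega
  have hTU : ∀ Q ∈ outerTraces H U, Q ⊆ U := by
    intro Q hQ
    obtain ⟨e, he, rfl⟩ := mem_image.1 hQ
    exact inter_subset_right
  have h0 : ∅ ∉ outerTraces H U := by
    intro h
    obtain ⟨e, he, he0⟩ := mem_image.1 h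
    rw [mem_filter] at he
    obtain ⟨M, h1, h2, h4, -⟩ := exists_partition_few_missing (s + 1) (insert v U)
      (by rw [card_insert_of_notMem hv, hU]; ring) ∅ (empty_subset _)
    have := hν M (fun e' he' => hpush e he.1 he.2 e' (h1 he') (by simp [he0])) h2
    omega
  set B := poorVertices H U A (6 * (p + 1)) with hB
  have hBU : B ⊆ U \ A := filter_subset _ _
  have hBp : #B ≤ p := hp ▸ card_le_card hBU
  have hmain : ∀ S ⊆ outerTraces H U, IsMatchingFam S →
      #(insert v B \ S.biUnion id) ≤ ∑ Q ∈ S, (3 - #Q) → #S ≤ p + 1 → False :=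
    fun S hS hSm hc hSp => not_disjoint_traces hU hv hAU hA hp (by omega) hν hpush hS
      (fun Q hQ => hT2 Q (hS hQ)) hSm hc hSp
  have hvB : #(insert v B) ≤ #B + 1 := card_insert_le _ _
  have hfew : ∀ S ⊆ outerTraces H U, IsMatchingFam S → #S ≤ #B := by
    intro S hS hSm
    by_contra hcon
    obtain ⟨S', hS', hc⟩ := exists_subset_card_eq (show #B + 1 ≤ #S by omega)
    refine hmain S' (hS'.trans hS) (hSm.mono hS') ?_ (by omega)
    calc #(insert v B \ S'.biUnion id) ≤ #(insert v B) := card_le_card sdiff_subset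
      _ ≤ #S' := by omega
      _ = ∑ Q ∈ S', 1 := by simp
      _ ≤ ∑ Q ∈ S', (3 - #Q) := sum_le_sum fun Q hQ => by
        have := hT2 Q (hS (hS' hQ)); omega
  have hsingle : ∀ Q ∈ outerTraces H U, #(insert v B \ Q) ≤ 3 - #Q → False := by
    intro Q hQ hc
    refine hmain {Q} (by simpa using hQ) (by simp [IsMatchingFam]) ?_ (by simp)
    simpa using hc
  have htr := card_le_of_traces h3 h0
  rw [hDc] at htr
  set T1 := {Q ∈ outerTraces H U | #Q = 1} with hT1
  set T2 := {Q ∈ outerTraces H U | #Q = 2} with hT2'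
  have hpascal : (3 * s + 2).choose 3 = (3 * s + 1).choose 3 + (3 * s + 1).choose 2 := by
    rw [Nat.choose_succ_succ' (3 * s + 1) 2]; ring
  obtain hr | hr | hr : #B = 0 ∨ #B = 1 ∨ 2 ≤ #B := by omega
  · obtain ⟨Q, hQ⟩ := nonempty_iff_ne_empty.2 hT
    have h1 := hT2 Q hQ
    have h2 : #(insert v B \ Q) ≤ #(insert v B) := card_le_card sdiff_subset
    exact hsingle Q hQ (by omega)
  · obtain ⟨z, hz⟩ := card_eq_one.1 hr
    have hzU : z ∈ U := (mem_sdiff.1 (hBU (hz ▸ mem_singleton_self z))).1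
    have hT1e : T1 = ∅ := by
      rw [hT1, filter_eq_empty_iff]
      intro Q hQ hQ1
      have h2 : #(insert v B \ Q) ≤ #(insert v B) := card_le_card sdiff_subset
      exact hsingle Q hQ (by omega)
    have hT2e : T2.Nonempty := by
      obtain ⟨Q, hQ⟩ := nonempty_iff_ne_empty.2 hT
      refine ⟨Q, mem_filter.2 ⟨hQ, ?_⟩⟩
      have h1 := hT2 Q hQ
      have h2 : #Q ≠ 0 := fun h => h0 (card_eq_zero.1 h ▸ hQ)
      have h4 : #Q ≠ 1 := fun h => by
        have : Q ∈ T1 := mem_filter.2 ⟨hQ, h⟩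
        rw [hT1e] at this
        simp at this
      omega
    have hzQ : ∀ Q ∈ T2, z ∉ Q := by
      intro Q hQ hzQ
      rw [mem_filter] at hQ
      refine hsingle Q hQ.1 ?_
      have : insert v B \ Q ⊆ {v} := by
        intro x hx
        rw [mem_sdiff, mem_insert, hz, mem_singleton] at hx
        rcases hx with ⟨rfl | rfl, h⟩
        · simp
        · exact absurd hzQ h
      have := card_le_card this
      rw [card_singleton] at this
      omega
    have hT2W : T2 ⊆ powersetCard 2 (U.erase z) := fun Q hQ => by
      have h1 := hzQ Q hQ
      rw [mem_filter] at hQ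
      exact mem_powersetCard.2 ⟨subset_erase.2 ⟨hTU Q hQ.1, h1⟩, hQ.2⟩
    have hint : ∀ P ∈ T2, ∀ Q ∈ T2, ¬Disjoint P Q := by
      intro P hP Q hQ hd
      rw [mem_filter] at hP hQ
      have hPQ : P ≠ Q := by
        rintro rfl
        rw [disjoint_self, bot_eq_empty] at hd
        rw [hd] at hP
        simp at hP
      have := hfew {P, Q} (by simp [insert_subset_iff, hP.1, hQ.1]) (by
        unfold IsMatchingFam
        rw [coe_pair, Set.pairwise_pair]
        exact fun _ => ⟨hd, hd.symm⟩)
      rw [card_pair hPQ] at this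
      omega
    have hcross : ∀ Q ∈ T2, ∀ P ∈ {P ∈ powersetCard 2 (U.erase z) | insert z P ∈ H},
        ¬Disjoint Q P := by
      intro Q hQ P hP hd
      have hzQ' := hzQ Q hQ
      rw [mem_filter] at hP hQ
      have hP' := mem_powersetCard.1 hP.1
      have hzP : z ∉ P := fun h => notMem_erase z U (hP'.1 h)
      have hPU : P ⊆ U := hP'.1.trans (erase_subset _ _)
      have hQU := hTU Q hQ.1
      have hvQ : v ∉ Q := fun h => hv (hQU h)
      have hvP : v ∉ P := fun h => hv (hPU h)
      have hvz : v ≠ z := fun h => hv (h ▸ hzU)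
      have hdis : Disjoint (insert v Q) (insert z P) := by
        rw [disjoint_insert_left, disjoint_insert_right, mem_insert, not_or]
        exact ⟨⟨hvz, hvP⟩, hzQ', hd⟩
      have hc1 : #(insert v Q) = 3 := by rw [card_insert_of_notMem hvQ, hQ.2]
      have hc2 : #(insert z P) = 3 := by rw [card_insert_of_notMem hzP, hP'.2]
      have hbi : ({insert v Q, insert z P} : Finset (Finset α)).biUnion id =
          insert v Q ∪ insert z P := by
        rw [biUnion_insert, singleton_biUnion]; rfl
      have hvQV : insert v Q ⊆ insert v U := insert_subset_insert _ hQU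
      obtain ⟨e, he, heQ⟩ := mem_image.1 hQ.1
      rw [mem_filter] at he
      have hvQH : insert v Q ∈ H := hpush e he.1 he.2 _ (mem_powersetCard.2 ⟨hvQV, hc1⟩)
        (heQ ▸ subset_insert _ _)
      refine not_covers_poorVertices (u := 6 * (p + 1)) (M := {insert v Q, insert z P})
        hU hv hAU hA hν (insert_subset hvQH (singleton_subset_iff.2 hP.2)) ?_ ?_ ?_ ?_ ?_
      · unfold IsMatchingFam
        rw [coe_pair, Set.pairwise_pair]
        exact fun _ => ⟨hdis, hdis.symm⟩
      · refine insert_subset (mem_powersetCard.2 ⟨hvQV, hc1⟩) (singleton_subset_iff.2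
          (mem_powersetCard.2 ⟨insert_subset (mem_insert_of_mem hzU)
            (hPU.trans (subset_insert _ _)), hc2⟩))
      · rw [hbi]; simp
      · rw [hbi, ← hB, hz]; simp
      · rw [hbi, card_union_of_disjoint hdis, hc1, hc2, hp]; omega
    have h1 := card_cross_intersecting_le (s := s) (D := D)
      (by rw [card_erase_of_mem hzU, hU]; rfl) hD2 (by omega) hT2W (filter_subset _ _) hT2e hint
      hcross
    have h2 := card_inside_le_of_link hzU h3
    rw [hU, show 3 * s + 2 - 1 = 3 * s + 1 by omega] at h2
    rw [hT1e, card_empty, zero_mul] at htr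
    omega
  · have hL : #A + p = 3 * s + 2 := by
      rw [← hp, ← hU, add_comm, card_sdiff_add_card_eq_card hAU]
    obtain ⟨b1, b2⟩ := deficiency_bounds hs hps hD hL
    have h1 : #T1 ≤ #B := by
      refine hfew T1 (filter_subset _ _) ?_
      intro P hP Q hQ hPQ
      rw [mem_coe, mem_filter] at hP hQ
      obtain ⟨a, rfl⟩ := card_eq_one.1 hP.2
      obtain ⟨b, rfl⟩ := card_eq_one.1 hQ.2
      rw [disjoint_singleton]
      rintro rfl
      exact hPQ rfl
    have h2 : #T2 ≤ 2 * #B * (3 * s + 2) := by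
      obtain ⟨S, hS1, hS2, hS3⟩ := exists_maximal_matching T2 fun Q hQ => by
        rw [mem_filter] at hQ
        exact card_pos.1 (by omega)
      have hSB := hfew S (hS1.trans (filter_subset _ _)) hS2
      have hc : #(S.biUnion id) ≤ #S * 2 := card_biUnion_le_card_mul _ _ _ fun Q hQ =>
        (mem_filter.1 (hS1 hQ)).2.le
      have : #T2 ≤ #(S.biUnion id) * #U := by
        refine (card_le_card fun Q hQ => ?_).trans (card_pairs_meeting_le (S.biUnion id) U)
        rw [mem_filter] at hQ
        exact mem_filter.2 ⟨mem_powersetCard.2 ⟨hTU Q hQ.1, hQ.2⟩,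
          hS3 Q (mem_filter.2 hQ)⟩
      rw [hU] at this
      exact this.trans (Nat.mul_le_mul_right _ (by omega))
    have h4 := card_inside_add_le (H := H) (m := (#A).choose 2 - 6 * (p + 1) * #A) hAU hBU
      (fun z hz => by
        have hz' := (mem_filter.1 hz).2
        have := card_filter_add_card_filter_not (s := powersetCard 2 A) (fun P => insert z P ∈ H)
        rw [card_powersetCard] at this
        omega) h3
    rw [hU, hpascal] at h4
    obtain ⟨Y, hY⟩ := Nat.exists_eq_add_of_le b1
    have hm : (#A).choose 2 - 6 * (p + 1) * #A = 2 * (3 * s + 2) * D + D.choose 2 + Y := by omega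
    rw [hm] at h4
    have h5 : #T2 * D ≤ 2 * #B * (3 * s + 2) * D := Nat.mul_le_mul_right _ h2
    have h6 : #T1 * D.choose 2 ≤ #B * D.choose 2 := Nat.mul_le_mul_right _ h1
    have h7 : 2 * Y ≤ #B * Y := Nat.mul_le_mul_right _ hr
    have h8 : #B * (2 * (3 * s + 2) * D + D.choose 2 + Y) =
      2 * #B * (3 * s + 2) * D + #B * D.choose 2 + #B * Y := by ring
    omega

end NearClique

/-- The vertices of `Fin n` with value below `m`. -/
def belowFin (n m : ℕ) : Finset (Fin n) := {x | (x : ℕ) < m}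

lemma mem_belowFin {n m : ℕ} {x : Fin n} : x ∈ belowFin n m ↔ (x : ℕ) < m := by
  simp [belowFin]

lemma card_belowFin {n m : ℕ} (h : m ≤ n) : #(belowFin n m) = m := by
  rw [belowFin, Fin.card_filter_val_lt, min_eq_right h]

/-- Stability for shifted families containing an almost full clique. -/
lemma IsShifted.subset_belowFin {n s L : ℕ} {H : Finset (Finset (Fin n))} (hH : IsShifted H)
    (h3 : H ⊆ completeEdges n 3) (hL : L ≤ 3 * s + 2) (hn : 3 * s + 4 ≤ n)
    (hs : 100000 ≤ s) (hD : 13 * (n - 3 * s - 2) ≤ 6 * s) (hp : 2000 * (3 * s + 2 - L) ≤ 3 * s)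
    (hA : ∀ e ∈ powersetCard 3 (belowFin n L), e ∈ H)
    (hν : ∀ M ⊆ H, IsMatchingFam M → #M ≤ s)
    (hcard : (3 * s + 1).choose 3 + 3 * s * (n - 3 * s - 1) < #H) :
    ∀ e ∈ H, e ⊆ belowFin n (3 * s + 2) := by
  have hsub : belowFin n L ⊆ belowFin n (3 * s + 2) := fun x hx => by
    rw [mem_belowFin] at hx ⊢; omega
  have h3' : ∀ e ∈ H, #e = 3 := fun e he => (mem_powersetCard.1 (h3 he)).2
  refine subset_of_near_clique (s := s) (p := 3 * s + 2 - L) (D := n - 3 * s - 2)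
    (v := ⟨3 * s + 2, by omega⟩) (card_belowFin (by omega)) (by simp [mem_belowFin]) hsub hA
    (by rw [card_sdiff_of_subset hsub, card_belowFin (by omega), card_belowFin (by omega)])
    (by rw [card_sdiff_of_subset (subset_univ _), card_univ, Fintype.card_fin,
          card_belowFin (by omega)]; omega)
    (by omega) hD hp hs h3' hν ?_ (by
      rwa [show n - 3 * s - 2 + 1 = n - 3 * s - 1 by omega])
  intro e he _ e' he' hee'
  rw [mem_powersetCard] at he'
  refine hH.mem_of_exchange he (by rw [he'.2, h3' e he]) fun y hy x hx => ?_
  rw [mem_sdiff] at hx hy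
  have hx' : 3 * s + 2 ≤ (x : ℕ) := by
    by_contra hlt
    exact hx.2 (hee' (mem_inter.2 ⟨hx.1, mem_belowFin.2 (not_le.1 hlt)⟩))
  have hy' : (y : ℕ) ≤ 3 * s + 2 := by
    rcases mem_insert.1 (he'.1 hy.1) with h | h
    · rw [h]
    · exact (mem_belowFin.1 h).le
  refine lt_of_le_of_ne (Fin.le_def.2 (hy'.trans hx')) ?_
  rintro rfl
  exact hx.2 hy.1

section FractionalStructure

variable {κ : Type*} [Fintype κ]

lemma sum_mul_card_fiber [DecidableEq κ] (g : κ → ℝ) (T : Fin 3 → κ) :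
    ∑ v, g v * (#{j | T j = v} : ℝ) = ∑ j, g (T j) := by
  simp_rw [card_filter, Nat.cast_sum, mul_sum]
  rw [sum_comm]
  simp

lemma card_le_sum_atLeastOne [DecidableEq κ] {E : Finset (Fin 3 → κ)} {w : κ → ℝ}
    (hw : ∀ T ∈ E, 1 ≤ ∑ j, w (T j)) :
    (#E : ℝ) ≤ ∑ x, ∑ y, ∑ z, atLeastOne (w x + w y + w z) := by
  have hinj : Set.InjOn (fun T : Fin 3 → κ => (T 0, T 1, T 2)) E := by
    intro S _ T _ h
    simp only [Prod.mk.injEq] at h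
    funext j
    fin_cases j
    exacts [h.1, h.2.1, h.2.2]
  have h1 : (#E : ℝ) = ∑ p ∈ E.image (fun T : Fin 3 → κ => (T 0, T 1, T 2)), (1 : ℝ) := by
    rw [sum_const, card_image_of_injOn hinj]; simp
  have h2 : ∑ x, ∑ y, ∑ z, atLeastOne (w x + w y + w z) =
      ∑ p : κ × κ × κ, atLeastOne (w p.1 + w p.2.1 + w p.2.2) := by
    simp_rw [Fintype.sum_prod_type]
  rw [h1, h2]
  refine (sum_le_sum fun p hp => ?_).trans
    (sum_le_sum_of_subset_of_nonneg (subset_univ _) fun _ _ _ => atLeastOne_nonneg _)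
  obtain ⟨T, hT, rfl⟩ := mem_image.1 hp
  have := hw T hT
  rw [Fin.sum_univ_three] at this
  simp [atLeastOne, this]

lemma sum_atLeastOne_eq {ι : Type*} [Fintype ι] (m : ι → ℝ) (a : ι → Fin 3 → ℝ) (τ : ℝ)
    (w : κ → ℝ)
    (hid : ∀ Φ : ℝ → ℝ, ∑ v, Φ (w v) = ∑ T, m T * (∑ j, Φ (a T j) + τ * Φ 0)) :
    ∑ x, ∑ y, ∑ z, atLeastOne (w x + w y + w z) =
      ∑ S, m S * ∑ T, m T * ∑ R, m R * localWeight τ (a S) (a T) (a R) := by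
  have h0 : atLeastOne 0 = 0 := by simp [atLeastOne]
  obtain ⟨F, hF⟩ : ∃ F : ℝ → ℝ, ∀ x, ∑ z, atLeastOne (x + w z) = F x := ⟨_, fun _ => rfl⟩
  have hF' : ∀ x, F x = ∑ R, m R * (∑ j, atLeastOne (x + a R j) + τ * atLeastOne (x + 0)) :=
    fun x => (hF x).symm.trans (hid fun z => atLeastOne (x + z))
  have hG : ∀ x, ∑ y, F (x + w y) = ∑ T, m T * (∑ j, F (x + a T j) + τ * F (x + 0)) :=
    fun x => hid fun y => F (x + y)
  simp only [hF]
  rw [hid fun x => ∑ y, F (x + w y)]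
  refine sum_congr rfl fun S _ => ?_
  congr 1
  simp only [hG, Fin.sum_univ_three]
  rw [mul_sum, ← sum_add_distrib, ← sum_add_distrib, ← sum_add_distrib]
  refine sum_congr rfl fun T _ => ?_
  simp only [hF', Fin.sum_univ_three, mul_sum, ← sum_add_distrib]
  refine sum_congr rfl fun R _ => ?_
  simp only [localWeight, Fin.sum_univ_three, add_zero, zero_add, h0]
  ring

lemma sum_cube_eq {ι : Type*} [Fintype ι] (m : ι → ℝ) (c : ℝ) :
    ∑ S, m S * ∑ T, m T * ∑ R, m R * c = c * (∑ S, m S) ^ 3 := by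
  simp only [← sum_mul]
  ring

lemma sum_localWeight_le_of_ge {ι : Type*} [Fintype ι] {m : ι → ℝ} {a : ι → Fin 3 → ℝ} {τ : ℝ}
    (hm : ∀ T, 0 ≤ m T) (ha0 : ∀ T j, 0 ≤ a T j) (ha : ∀ T, m T ≠ 0 → ∑ j, a T j = 1)
    (hτ : 47 / 100 ≤ τ) :
    ∑ S, m S * ∑ T, m T * ∑ R, m R * localWeight τ (a S) (a T) (a R) ≤
      27 * ((3 + τ) / (347 / 100)) ^ 3 * (∑ S, m S) ^ 3 := by
  have hwt : ∀ (T : ι) (x y : ℝ), (m T ≠ 0 → x ≤ y) → m T * x ≤ m T * y := fun T x y h => by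
    by_cases h0 : m T = 0
    · simp [h0]
    · exact mul_le_mul_of_nonneg_left (h h0) (hm T)
  rw [← sum_cube_eq]
  refine sum_le_sum fun S _ => hwt S _ _ fun hS => sum_le_sum fun T _ => hwt T _ _ fun hT =>
    sum_le_sum fun R _ => hwt R _ _ fun hR => ?_
  exact localWeight_le_of_ge τ hτ _ _ _ (ha S hS) (ha T hT) (ha R hR) (ha0 S) (ha0 T) (ha0 R)

open scoped Classical in
lemma sum_localWeight_le_of_le {ι : Type*} [Fintype ι] {m : ι → ℝ} {a : ι → Fin 3 → ℝ} {τ : ℝ}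
    (hm : ∀ T, 0 ≤ m T) (ha0 : ∀ T j, 0 ≤ a T j) (ha : ∀ T, m T ≠ 0 → ∑ j, a T j = 1)
    (hτ0 : 0 ≤ τ) (hτ : τ ≤ 47 / 100) :
    ∑ S, m S * ∑ T, m T * ∑ R, m R * localWeight τ (a S) (a T) (a R) ≤
      (27 - 1 / 4) * (∑ S, m S) ^ 3 + 1 / 4 * (∑ S with ∀ j, a S j = 1 / 3, m S) ^ 3 := by
  have hwt : ∀ (T : ι) (x y : ℝ), (m T ≠ 0 → x ≤ y) → m T * x ≤ m T * y := fun T x y h => by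
    by_cases h0 : m T = 0
    · simp [h0]
    · exact mul_le_mul_of_nonneg_left (h h0) (hm T)
  set t : ι → ℝ := fun S => if ∀ j, a S j = 1 / 3 then 1 else 0 with ht
  have hsum : ∑ S with ∀ j, a S j = 1 / 3, m S = ∑ S, m S * t S := by
    rw [sum_filter]
    refine sum_congr rfl fun S _ => ?_
    by_cases h : ∀ j, a S j = 1 / 3 <;> simp [ht, h]
  have hexp : ∑ S, m S * ∑ T, m T * ∑ R, m R * (27 - 1 / 4 + 1 / 4 * (t S * (t T * t R))) =
      (27 - 1 / 4) * (∑ S, m S) ^ 3 + 1 / 4 * (∑ S, m S * t S) ^ 3 := by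
    have e1 : ∀ S T, ∑ R, m R * (27 - 1 / 4 + 1 / 4 * (t S * (t T * t R))) =
        (27 - 1 / 4) * ∑ R, m R + 1 / 4 * t S * t T * ∑ R, m R * t R := fun S T => by
      rw [mul_sum, mul_sum, ← sum_add_distrib]
      exact sum_congr rfl fun _ _ => by ring
    have e2 : ∀ S x y, ∑ T, m T * ((27 - 1 / 4) * x + 1 / 4 * t S * t T * y) =
        (27 - 1 / 4) * x * (∑ T, m T) + 1 / 4 * t S * y * ∑ T, m T * t T := fun S x y => by
      rw [mul_sum, mul_sum, ← sum_add_distrib]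
      exact sum_congr rfl fun _ _ => by ring
    have e3 : ∀ x y z, ∑ S, m S * ((27 - 1 / 4) * x * z + 1 / 4 * t S * y * y) =
        (27 - 1 / 4) * x * z * (∑ S, m S) + 1 / 4 * y * y * ∑ S, m S * t S := fun x y z => by
      rw [mul_sum, mul_sum, ← sum_add_distrib]
      exact sum_congr rfl fun _ _ => by ring
    simp only [e1, e2, e3]
    ring
  rw [hsum, ← hexp]
  refine sum_le_sum fun S _ => hwt S _ _ fun hS => sum_le_sum fun T _ => hwt T _ _ fun hT =>
    sum_le_sum fun R _ => hwt R _ _ fun hR => ?_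
  by_cases h : (∀ i, a S i = 1 / 3) ∧ (∀ i, a T i = 1 / 3) ∧ (∀ i, a R i = 1 / 3)
  · rw [localWeight_third τ _ _ _ h.1 h.2.1 h.2.2]
    simp only [ht, if_pos h.1, if_pos h.2.1, if_pos h.2.2]
    norm_num
  · refine (localWeight_le_of_le τ hτ0 hτ _ _ _ (ha S hS) (ha T hT) (ha R hR) (ha0 S) (ha0 T)
      (ha0 R) h).trans ?_
    have h01 : ∀ S, 0 ≤ t S := fun S => by
      simp only [ht]; split_ifs <;> norm_num
    have := mul_nonneg (h01 S) (mul_nonneg (h01 T) (h01 R))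
    linarith

end FractionalStructure

section FractionalStructureTheorem

variable {κ : Type*} [Fintype κ]

lemma card_filter_exists_mem_le [DecidableEq κ] (B : Finset κ) (E : Finset (Fin 3 → κ)) :
    #{T ∈ E | ∃ j, T j ∈ B} ≤ 3 * #B * Fintype.card κ ^ 2 := by
  have h : {T ∈ E | ∃ j, T j ∈ B} ⊆ univ.biUnion fun j : Fin 3 =>
      Fintype.piFinset fun i => if i = j then B else univ := by
    intro T hT
    obtain ⟨j, hj⟩ := (mem_filter.1 hT).2
    simp only [mem_biUnion, mem_univ, true_and, Fintype.mem_piFinset]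
    refine ⟨j, fun i => ?_⟩
    split_ifs with h
    · rwa [h]
    · exact mem_univ _
  refine (card_le_card h).trans (card_biUnion_le.trans ?_)
  simp only [Fintype.card_piFinset, Fin.sum_univ_three, Fin.prod_univ_three]
  simp
  apply le_of_eq
  ring

lemma exists_fractional_structure [DecidableEq κ] {E : Finset (Fin 3 → κ)} (hE : E.Nonempty) :
    ∃ m : E → ℝ, (∀ T, 0 ≤ m T) ∧ (∀ v, ∑ T, m T * (#{j | T.1 j = v} : ℝ) ≤ 1) ∧
      ((#E : ℝ) ≤ 27 / (347 / 100) ^ 3 * (Fintype.card κ : ℝ) ^ 3 ∨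
        ∃ Q : Finset κ, (#Q : ℝ) ≤ 3 * ∑ T, m T ∧
          (#{T ∈ E | ¬ ∀ j, T j ∈ Q} : ℝ) * (∑ T, m T) ^ 2 ≤
            36 * (Fintype.card κ : ℝ) ^ 2 * (27 * (∑ T, m T) ^ 3 - #E)) := by
  classical
  obtain ⟨m, w, hm, hw, hload, hcov, hsum⟩ := exists_fractional_packing_cover
    (fun (T : E) (v : κ) => (#{j | T.1 j = v} : ℝ)) (fun _ _ => Nat.cast_nonneg _) (fun T =>
      ⟨T.1 0, by exact_mod_cast card_pos.2 ⟨0, by simp⟩⟩)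
  refine ⟨m, hm, hload, ?_⟩
  simp only [sum_mul_card_fiber] at hcov
  have hexch : ∀ g : κ → ℝ, ∑ v, g v * ∑ T, m T * (#{j | T.1 j = v} : ℝ) =
      ∑ T : E, m T * ∑ j, g (T.1 j) := fun g => by
    simp_rw [← sum_mul_card_fiber g, mul_sum]
    rw [sum_comm]
    exact sum_congr rfl fun _ _ => sum_congr rfl fun _ _ => by ring
  set load : κ → ℝ := fun v => ∑ T, m T * (#{j | T.1 j = v} : ℝ) with hloaddef
  set ν := ∑ T, m T with hν
  set K : ℝ := (Fintype.card κ : ℝ) with hK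
  have hslack : ∑ T : E, m T * (∑ j, w (T.1 j) - 1) + ∑ v, w v * (1 - load v) = 0 := by
    simp only [mul_sub, sum_sub_distrib, mul_one, ← hexch w, ← hsum]
    ring
  have hp1 : ∀ T : E, 0 ≤ m T * (∑ j, w (T.1 j) - 1) := fun T =>
    mul_nonneg (hm T) (by linarith [hcov T])
  have hp2 : ∀ v, 0 ≤ w v * (1 - load v) := fun v =>
    mul_nonneg (hw v) (by linarith [hload v])
  have hs1 := sum_nonneg fun T (_ : T ∈ univ) => hp1 T
  have hs2 := sum_nonneg fun v (_ : v ∈ univ) => hp2 v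
  have hz1 : ∀ T : E, m T * (∑ j, w (T.1 j) - 1) = 0 := fun T =>
    (sum_eq_zero_iff_of_nonneg fun T _ => hp1 T).1 (by linarith) T (mem_univ T)
  have hz2 : ∀ v, w v * (1 - load v) = 0 := fun v =>
    (sum_eq_zero_iff_of_nonneg fun v _ => hp2 v).1 (by linarith) v (mem_univ v)
  have hνpos : 0 < ν := by
    rw [hsum]
    refine lt_of_le_of_ne (sum_nonneg fun v _ => hw v) fun h0 => ?_
    obtain ⟨T, hT⟩ := hE
    have hall := (sum_eq_zero_iff_of_nonneg fun v _ => hw v).1 h0.symm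
    have := hcov ⟨T, hT⟩
    simp only [hall _ (mem_univ _), sum_const_zero] at this
    linarith
  have hload3 : ∑ v, load v = 3 * ν := by
    have := hexch fun _ => 1
    simp only [one_mul, sum_const, card_univ, Fintype.card_fin, ← sum_mul, nsmul_eq_mul] at this
    rw [this]; push_cast; ring
  have hKν : 3 * ν ≤ K := by
    rw [← hload3]
    refine (sum_le_sum fun v _ => hload v).trans ?_
    simp [hK]
  obtain ⟨τ, hτ⟩ : ∃ τ, τ * ν = K - 3 * ν := ⟨(K - 3 * ν) / ν, by field_simp⟩
  have hτ0 : 0 ≤ τ := by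
    by_contra! h
    nlinarith
  have hid : ∀ Φ : ℝ → ℝ, ∑ v, Φ (w v) =
      ∑ T : E, m T * (∑ j, Φ (w (T.1 j)) + τ * Φ 0) := fun Φ => by
    simp only [mul_add, sum_add_distrib, ← hexch fun v => Φ (w v), ← sum_mul]
    have h1 : ∀ v, Φ (w v) = Φ (w v) * load v + Φ 0 * (1 - load v) := fun v => by
      rcases mul_eq_zero.1 (hz2 v) with h | h
      · rw [h]; ring
      · rw [h, show load v = 1 by linarith]; ring
    have h2 : ∑ v, (1 - load v) = τ * ν := by
      rw [sum_sub_distrib, hload3, hτ]; simp [hK]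
    rw [sum_congr rfl fun v _ => h1 v, sum_add_distrib, ← mul_sum, h2]
    ring
  have ha : ∀ T : E, m T ≠ 0 → ∑ j, w (T.1 j) = 1 := fun T hT => by
    rcases mul_eq_zero.1 (hz1 T) with h | h
    · exact absurd h hT
    · linarith
  have hEle : (#E : ℝ) ≤ _ := card_le_sum_atLeastOne fun T hT => hcov ⟨T, hT⟩
  rw [sum_atLeastOne_eq m (fun T j => w (T.1 j)) τ w hid] at hEle
  rcases le_total (47 / 100) τ with hτ' | hτ'
  · left
    refine hEle.trans ((sum_localWeight_le_of_ge hm (fun T j => hw _) ha hτ').trans ?_)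
    rw [show K = (3 + τ) * ν by linarith]
    apply le_of_eq
    rw [← hν]
    ring
  · right
    have hE2 := hEle.trans (sum_localWeight_le_of_le hm (fun T j => hw _) ha hτ0 hτ')
    rw [← hν] at hE2
    set ν₀ := ∑ S : E with ∀ j, w (S.1 j) = 1 / 3, m S with hν₀
    have hν₀0 : 0 ≤ ν₀ := sum_nonneg fun S _ => hm S
    have hsplit : ν = ν₀ + ∑ S : E with ¬ ∀ j, w (S.1 j) = 1 / 3, m S :=
      (sum_filter_add_sum_filter_not _ _ _).symm
    have hν₀ν : ν₀ ≤ ν := by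
      rw [hsplit]; linarith [sum_nonneg fun S (_ : S ∈ ({S : E | ¬ ∀ j, w (S.1 j) = 1 / 3} :
        Finset E)) => hm S]
    refine ⟨({v | w v = 1 / 3} : Finset κ), ?_, ?_⟩
    · rw [hsum]
      have : ∑ v with w v = 1 / 3, w v ≤ ∑ v, w v :=
        sum_le_sum_of_subset_of_nonneg (filter_subset _ _) fun v _ _ => hw v
      rw [sum_congr rfl (g := fun _ => (1 / 3 : ℝ)) fun v hv => (mem_filter.1 hv).2, sum_const,
        nsmul_eq_mul] at this
      linarith
    · set B : Finset κ := {v | 1 / 3 < w v} with hB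
      have hBcard : (#B : ℝ) ≤ 3 * (ν - ν₀) := by
        have h1 : (#B : ℝ) = ∑ v, (if 1 / 3 < w v then 1 else 0) * load v := by
          rw [hB, card_filter]
          push_cast
          refine sum_congr rfl fun v _ => ?_
          split_ifs with h
          · rcases mul_eq_zero.1 (hz2 v) with h' | h' <;> linarith
          · simp
        rw [h1, hexch fun v => if 1 / 3 < w v then 1 else 0, hsplit, add_sub_cancel_left,
          mul_sum, sum_filter]
        refine sum_le_sum fun T _ => ?_
        split_ifs with h
        · simp [h]
        · rw [mul_comm]
          refine mul_le_mul_of_nonneg_right ?_ (hm T)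
          refine (sum_le_sum (g := fun _ => (1 : ℝ)) fun j _ => ?_).trans (by simp)
          split_ifs <;> norm_num
      have hbad : ({T ∈ E | ¬ ∀ j, T j ∈ ({v | w v = 1 / 3} : Finset κ)}) ⊆
          {T ∈ E | ∃ j, T j ∈ B} := by
        intro T hT
        rw [mem_filter] at hT ⊢
        refine ⟨hT.1, ?_⟩
        by_contra! hno
        apply hT.2
        have hc := hcov ⟨T, hT.1⟩
        simp only [hB, mem_filter, mem_univ, true_and, not_lt] at hno ⊢
        simp only [Fin.sum_univ_three] at hc
        have := hno 0
        have := hno 1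
        have := hno 2
        intro j
        fin_cases j <;> simp <;> linarith
      have hbc : (#{T ∈ E | ¬ ∀ j, T j ∈ ({v | w v = 1 / 3} : Finset κ)} : ℝ) ≤
          3 * #B * K ^ 2 := by
        rw [hK]
        exact_mod_cast (card_le_card hbad).trans (card_filter_exists_mem_le B E)
      have hcube : (ν - ν₀) * ν ^ 2 ≤ 4 * (27 * ν ^ 3 - #E) := by
        have : (ν - ν₀) * ν ^ 2 ≤ ν ^ 3 - ν₀ ^ 3 := by
          nlinarith [mul_nonneg hν₀0 (mul_nonneg (sub_nonneg.2 hν₀ν) (add_nonneg hνpos.le hν₀0))]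
        linarith
      calc _ ≤ 3 * #B * K ^ 2 * ν ^ 2 := mul_le_mul_of_nonneg_right hbc (by positivity)
        _ ≤ 3 * (3 * (ν - ν₀)) * K ^ 2 * ν ^ 2 := by gcongr
        _ = 9 * K ^ 2 * ((ν - ν₀) * ν ^ 2) := by ring
        _ ≤ 9 * K ^ 2 * (4 * (27 * ν ^ 3 - #E)) := by gcongr
        _ = _ := by ring

end FractionalStructureTheorem

section Blocks

variable {n K b s : ℕ} {H : Finset (Finset (Fin n))}

/-- Integral rounding: block multiplicities with loads at most `b` yield a matching. -/
lemma IsShifted.sum_multiplicity_le (hH : IsShifted H)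
    (hν : ∀ M ⊆ H, IsMatchingFam M → #M ≤ s) (hKb : K * b ≤ n) {E : Finset (Fin 3 → Fin K)}
    (hE : ∀ T ∈ E, ∃ x : Fin 3 → Fin n, Function.Injective x ∧ univ.image x ∈ H ∧
      ∀ j, ((T j : ℕ) + 1) * b ≤ x j)
    (c : E → ℕ) (hc : ∀ v, ∑ T, c T * #{j | T.1 j = v} ≤ b) : ∑ T, c T ≤ s := by
  classical
  let σ := Σ T : E, Fin (c T)
  let blk : σ × Fin 3 → Fin K := fun p => p.1.1.1 p.2
  have hfib : ∀ v, Nonempty ({p : σ × Fin 3 // blk p = v} ↪ Fin b) := fun v => by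
    refine Function.Embedding.nonempty_of_card_le ?_
    rw [Fintype.card_fin, Fintype.card_subtype]
    refine le_trans (le_of_eq ?_) (hc v)
    rw [card_filter, Fintype.sum_prod_type, Fintype.sum_sigma]
    refine sum_congr rfl fun T _ => ?_
    rw [card_filter]
    simp [blk]
  let f := fun v => (hfib v).some
  have hlt : ∀ v : Fin K, ∀ i : Fin b, (v : ℕ) * b + i < (v + 1) * b := fun v i => by
    rw [add_mul, one_mul]
    exact Nat.add_lt_add_left i.2 _
  have hle : ∀ v : Fin K, ((v : ℕ) + 1) * b ≤ n := fun v =>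
    (Nat.mul_le_mul_right b v.2).trans hKb
  let φ : σ × Fin 3 → Fin n := fun p =>
    ⟨(blk p : ℕ) * b + f (blk p) ⟨p, rfl⟩, (hlt _ _).trans_le (hle _)⟩
  have hφ : Function.Injective φ := by
    intro p q hpq
    have hpq' : (blk p : ℕ) * b + f (blk p) ⟨p, rfl⟩ = blk q * b + f (blk q) ⟨q, rfl⟩ :=
      congrArg Fin.val hpq
    have hb : blk p = blk q := by
      by_contra hne
      rcases lt_or_gt_of_ne hne with h | h
      · have := Nat.mul_le_mul_right b (show (blk p : ℕ) + 1 ≤ blk q from h)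
        have := hlt (blk p) (f (blk p) ⟨p, rfl⟩)
        omega
      · have := Nat.mul_le_mul_right b (show (blk q : ℕ) + 1 ≤ blk p from h)
        have := hlt (blk q) (f (blk q) ⟨q, rfl⟩)
        omega
    have hval : ∀ v (h : blk p = v), (f (blk p) ⟨p, rfl⟩ : ℕ) = f v ⟨p, h⟩ := by
      rintro v rfl; rfl
    rw [hval _ hb, hb] at hpq'
    have := (f (blk q)).injective (Fin.ext (Nat.add_left_cancel hpq'))
    exact congrArg Subtype.val this
  let g : σ → Finset (Fin n) := fun t => univ.image fun j => φ (t, j)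
  have hgH : ∀ t, g t ∈ H := fun t => by
    obtain ⟨x, hx, hxH, hxb⟩ := hE t.1.1 t.1.2
    refine hH.image_mem x _ hx (fun i j h => ?_) (fun j => ?_) hxH
    · exact (Prod.mk.inj (hφ h)).2
    · exact (hlt _ _).le.trans (hxb j)
  have hdisj : ∀ t u, t ≠ u → Disjoint (g t) (g u) := fun t u htu => by
    rw [disjoint_left]
    intro y hy hy'
    obtain ⟨i, -, rfl⟩ := mem_image.1 hy
    obtain ⟨j, -, hj⟩ := mem_image.1 hy'
    exact htu (Prod.mk.inj (hφ hj)).1.symm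
  have hginj : Function.Injective g := fun t u h => by
    by_contra hne
    have := hdisj t u hne
    rw [← h, disjoint_self] at this
    exact (univ_nonempty.image fun j => φ (t, j)).ne_empty this
  have := hν (univ.image g) (image_subset_iff.2 fun t _ => hgH t) (by
    unfold IsMatchingFam
    rw [coe_image, coe_univ, Set.image_univ]
    rintro _ ⟨t, rfl⟩ _ ⟨u, rfl⟩ hne
    exact hdisj t u fun h => hne (by rw [h]))
  rwa [card_image_of_injective _ hginj, card_univ, Fintype.card_sigma,
    sum_congr rfl fun T _ => Fintype.card_fin (c T)] at this

lemma IsShifted.sum_fractional_mul_le (hH : IsShifted H)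
    (hν : ∀ M ⊆ H, IsMatchingFam M → #M ≤ s) (hKb : K * b ≤ n) {E : Finset (Fin 3 → Fin K)}
    (hE : ∀ T ∈ E, ∃ x : Fin 3 → Fin n, Function.Injective x ∧ univ.image x ∈ H ∧
      ∀ j, ((T j : ℕ) + 1) * b ≤ x j)
    (m : E → ℝ) (hm : ∀ T, 0 ≤ m T) (hload : ∀ v, ∑ T, m T * (#{j | T.1 j = v} : ℝ) ≤ 1) :
    (∑ T, m T) * b ≤ s + (K : ℝ) ^ 3 := by
  have h1 : ∑ T, ⌊m T * b⌋₊ ≤ s := by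
    refine hH.sum_multiplicity_le hν hKb hE _ fun v => ?_
    have : ∑ T, (⌊m T * b⌋₊ : ℝ) * (#{j | T.1 j = v} : ℝ) ≤ b := by
      calc _ ≤ ∑ T, m T * b * (#{j | T.1 j = v} : ℝ) := sum_le_sum fun T _ =>
            mul_le_mul_of_nonneg_right (Nat.floor_le (mul_nonneg (hm T) b.cast_nonneg))
              (Nat.cast_nonneg _)
        _ = (∑ T, m T * (#{j | T.1 j = v} : ℝ)) * b := by
            rw [sum_mul]; exact sum_congr rfl fun _ _ => by ring
        _ ≤ 1 * b := mul_le_mul_of_nonneg_right (hload v) b.cast_nonneg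
        _ = b := one_mul _
    exact_mod_cast this
  have h2 : (#E : ℝ) ≤ (K : ℝ) ^ 3 := by
    have := card_le_univ E
    rw [Fintype.card_fun, Fintype.card_fin, Fintype.card_fin] at this
    exact_mod_cast this
  calc (∑ T, m T) * b = ∑ T, m T * b := sum_mul _ _ _
    _ ≤ ∑ T, ((⌊m T * b⌋₊ : ℝ) + 1) := sum_le_sum fun T _ => (Nat.lt_floor_add_one _).le
    _ = ((∑ T, ⌊m T * b⌋₊ : ℕ) : ℝ) + #E := by
        rw [sum_add_distrib]; simp
    _ ≤ s + (K : ℝ) ^ 3 := add_le_add (by exact_mod_cast h1) h2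

/-- Ordered triples of distinct vertices spanning a member of `H`. -/
def orderedEdges (H : Finset (Finset (Fin n))) : Finset (Fin 3 → Fin n) :=
  {x | Function.Injective x ∧ univ.image x ∈ H}

lemma mem_orderedEdges {x : Fin 3 → Fin n} :
    x ∈ orderedEdges H ↔ Function.Injective x ∧ univ.image x ∈ H := by
  simp [orderedEdges]

lemma six_mul_card_le_card_orderedEdges (h3 : H ⊆ completeEdges n 3) :
    6 * #H ≤ #(orderedEdges H) := by
  rw [card_eq_sum_card_fiberwise (f := fun x : Fin 3 → Fin n => univ.image x) (t := H)
    fun x hx => (mem_orderedEdges.1 hx).2, mul_comm, ← smul_eq_mul]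
  refine card_nsmul_le_sum _ _ _ fun e he => ?_
  have hcard : #e = 3 := (mem_powersetCard.1 (h3 he)).2
  let g : Fin 3 ≃ e := (e.orderIsoOfFin hcard).toEquiv
  have h6 : #(univ : Finset (Equiv.Perm (Fin 3))) = 6 := by
    rw [card_univ, Fintype.card_perm, Fintype.card_fin]; rfl
  rw [← h6]
  refine card_le_card_of_injOn (fun π j => (g (π j) : Fin n)) (fun π _ => ?_) fun π _ ρ _ h => ?_
  · have him : univ.image (fun j => (g (π j) : Fin n)) = e := by
      ext y
      simp only [mem_image, mem_univ, true_and]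
      constructor
      · rintro ⟨j, rfl⟩
        exact (g (π j)).2
      · intro hy
        exact ⟨π.symm (g.symm ⟨y, hy⟩), by simp⟩
    rw [mem_coe, mem_filter, mem_orderedEdges, him]
    exact ⟨⟨fun i j h => π.injective (g.injective (Subtype.ext h)), he⟩, rfl⟩
  · ext j
    have := congrFun h j
    rw [g.injective (Subtype.ext this)]

lemma card_filter_div_eq_le (hb : 0 < b) (t : ℕ) : #{y : Fin n | (y : ℕ) / b = t} ≤ b := by
  rw [← card_range b]
  refine card_le_card_of_injOn (fun y => (y : ℕ) % b)
    (fun y _ => mem_coe.2 (mem_range.2 (Nat.mod_lt _ hb))) fun y hy z hz h => ?_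
  have hy' : (y : ℕ) / b = t := by simpa using hy
  have hz' : (z : ℕ) / b = t := by simpa using hz
  apply Fin.ext
  rw [← Nat.div_add_mod (y : ℕ) b, ← Nat.div_add_mod (z : ℕ) b, hy', hz']
  exact congrArg _ h

lemma card_filter_exists_block_le (hb : 0 < b) (S : Finset (Fin 3 → Fin K)) :
    #{x : Fin 3 → Fin n | ∃ T ∈ S, ∀ j, (x j : ℕ) / b = T j + 1} ≤ #S * b ^ 3 := by
  have h : ({x : Fin 3 → Fin n | ∃ T ∈ S, ∀ j, (x j : ℕ) / b = T j + 1} :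
      Finset (Fin 3 → Fin n)) ⊆ S.biUnion fun T => Fintype.piFinset fun j =>
        ({y : Fin n | (y : ℕ) / b = T j + 1} : Finset (Fin n)) := by
    intro x hx
    obtain ⟨T, hT, hx⟩ := (mem_filter.1 hx).2
    exact mem_biUnion.2 ⟨T, hT, Fintype.mem_piFinset.2 fun j => by simp [hx j]⟩
  refine (card_le_card h).trans (card_biUnion_le_card_mul _ _ _ fun T _ => ?_)
  rw [Fintype.card_piFinset]
  refine (prod_le_pow_card _ _ _ fun j _ => card_filter_div_eq_le hb _).trans ?_
  simp

lemma card_filter_mem_block_le (hb : 0 < b) (Q : Finset (Fin K)) :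
    #{y : Fin n | ∃ v ∈ Q, (y : ℕ) / b = v + 1} ≤ #Q * b := by
  have h : ({y : Fin n | ∃ v ∈ Q, (y : ℕ) / b = v + 1} : Finset (Fin n)) ⊆
      Q.biUnion fun v => {y : Fin n | (y : ℕ) / b = v + 1} := by
    intro y hy
    obtain ⟨v, hv, hy⟩ := (mem_filter.1 hy).2
    exact mem_biUnion.2 ⟨v, hv, by simp [hy]⟩
  exact (card_le_card h).trans (card_biUnion_le_card_mul _ _ _ fun v _ =>
    card_filter_div_eq_le hb _)

lemma card_filter_exists_lt_le (hb : b ≤ n) :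
    #{x : Fin 3 → Fin n | ∃ j, (x j : ℕ) < b} ≤ 3 * b * n ^ 2 := by
  have := card_filter_exists_mem_le (belowFin n b) univ
  rw [card_belowFin hb, Fintype.card_fin] at this
  simpa only [mem_belowFin] using this

lemma card_filter_forall_mem_exists_lt_le {L P : ℝ} {L' : ℕ} (V : Finset (Fin n))
    (hL : (L' : ℝ) ≤ L) (hLP : L ≤ P) (hV : (#V : ℝ) ≤ P) :
    (#{x : Fin 3 → Fin n | (∀ j, x j ∈ V) ∧ ∃ j, (x j : ℕ) < L'} : ℝ) ≤
      P ^ 3 - (P - L) ^ 3 := by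
  set W : Finset (Fin n) := {y ∈ V | L' ≤ (y : ℕ)} with hW
  have hsub : (Fintype.piFinset fun _ : Fin 3 => W) ⊆ Fintype.piFinset fun _ : Fin 3 => V :=
    Fintype.piFinset_subset _ _ fun _ => filter_subset _ _
  have heq : ({x : Fin 3 → Fin n | (∀ j, x j ∈ V) ∧ ∃ j, (x j : ℕ) < L'} :
      Finset (Fin 3 → Fin n)) =
      (Fintype.piFinset fun _ : Fin 3 => V) \ Fintype.piFinset fun _ : Fin 3 => W := by
    ext x
    simp only [mem_filter, mem_univ, true_and, mem_sdiff, Fintype.mem_piFinset, hW, not_forall,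
      not_and, not_le]
    constructor
    · rintro ⟨h, j, hj⟩
      exact ⟨h, j, fun _ => hj⟩
    · rintro ⟨h, j, hj⟩
      exact ⟨h, j, hj (h j)⟩
  have hc := card_sdiff_add_card_eq_card hsub
  rw [← heq] at hc
  simp only [Fintype.card_piFinset_const] at hc
  have hWV : #W ≤ #V := card_le_card (filter_subset _ _)
  have hVW : #V ≤ #W + L' := by
    have h1 := card_filter_add_card_filter_not (s := V) (fun y : Fin n => L' ≤ (y : ℕ))
    have h2 : #{y ∈ V | ¬ L' ≤ (Fin.val y)} ≤ L' := by
      rw [← card_range L']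
      refine card_le_card_of_injOn (fun y => (y : ℕ)) (fun y hy => ?_)
        fun _ _ _ _ h => Fin.ext h
      simpa using (mem_filter.1 hy).2
    rw [← hW] at h1
    omega
  have hc' : (#{x : Fin 3 → Fin n | (∀ j, x j ∈ V) ∧ ∃ j, (x j : ℕ) < L'} : ℝ) =
      (#V : ℝ) ^ 3 - (#W : ℝ) ^ 3 := by
    rw [eq_sub_iff_add_eq]
    exact_mod_cast hc
  rw [hc']
  have hw0 : (0 : ℝ) ≤ #W := Nat.cast_nonneg _
  have hd0 : (#W : ℝ) ≤ #V := by exact_mod_cast hWV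
  have hd : (#V : ℝ) ≤ #W + L' := by exact_mod_cast hVW
  obtain ⟨d, hd'⟩ : ∃ d : ℝ, d = #V - #W := ⟨_, rfl⟩
  rw [show (#W : ℝ) = #V - d by linarith]
  have hd1 : 0 ≤ d := by linarith
  have e1 : (P - L) ^ 3 ≤ (P - d) ^ 3 := pow_le_pow_left₀ (by linarith) (by linarith) 3
  have e2 : d * ((#V : ℝ) ^ 2 + #V * (#V - d) + (#V - d) ^ 2) ≤
      d * (P ^ 2 + P * (P - d) + (P - d) ^ 2) := by
    have : (0 : ℝ) ≤ #V - d := by linarith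
    have : 0 ≤ P := by linarith
    gcongr
  nlinarith

end Blocks

section InitialClique

lemma sparse_blocks_absurd {N S B F : ℝ} (hN : 10 ^ 20 ≤ N) (hs : 13 * N ≤ 45 * S)
    (hsN : 3 * S ≤ N) (hB : B ≤ N / 10 ^ 18) (hF : F ≤ 27 / (347 / 100) ^ 3 * N ^ 3)
    (hc : 27 * S ^ 3 - 3 * S ≤ 3 * B * N ^ 2 + F) : False := by
  have h1 : (13 / 45 * N) ^ 3 ≤ S ^ 3 := pow_le_pow_left₀ (by linarith) (by linarith) 3
  have h2 : B * N ^ 2 ≤ N / 10 ^ 18 * N ^ 2 := by gcongr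
  have h3 : N * (10 ^ 20) ^ 2 ≤ N * N ^ 2 := by gcongr
  have h4 : 0 < N ^ 3 := by positivity
  have h5 : N * N ^ 2 = N ^ 3 := by ring
  norm_num at *
  nlinarith

lemma near_clique_blocks_absurd {N S B F X Y L : ℝ} (hN : 10 ^ 20 ≤ N) (hs : 13 * N ≤ 45 * S)
    (hsN : 3 * S ≤ N) (hB : B ≤ N / 10 ^ 18) (hX0 : 0 ≤ X) (hX : X ≤ S + N / 10 ^ 18)
    (hF : F ≤ 27 * X ^ 3)
    (hY : Y * X ^ 2 ≤ 36 * N ^ 2 * (27 * X ^ 3 - F))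
    (hc : 27 * S ^ 3 - 3 * S ≤ 3 * B * N ^ 2 + F)
    (hL : L ≤ 3 * S - S / 1000 + 1)
    (hc' : 27 * S ^ 3 - 3 * S ≤ 3 * B * N ^ 2 + Y + ((3 * (S + N / 10 ^ 18)) ^ 3 -
      (3 * (S + N / 10 ^ 18) - L) ^ 3)) : False := by
  have hN0 : 0 < N := by linarith
  have hS0 : 0 < S := by linarith
  have h1 : (13 / 45 * N) ^ 3 ≤ S ^ 3 := pow_le_pow_left₀ (by linarith) (by linarith) 3
  have h2 : B * N ^ 2 ≤ N / 10 ^ 18 * N ^ 2 := by gcongr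
  have h3 : N * (10 ^ 20) ^ 2 ≤ N * N ^ 2 := by gcongr
  have h4 : 0 < N ^ 3 := by positivity
  have h5 : N * N ^ 2 = N ^ 3 := by ring
  have h6 : (S + N / 10 ^ 18) ^ 3 ≤ S ^ 3 + N ^ 3 / 10 ^ 18 := by
    have e1 : (S + N / 10 ^ 18) ^ 3 - S ^ 3 = N / 10 ^ 18 * ((S + N / 10 ^ 18) ^ 2 +
      (S + N / 10 ^ 18) * S + S ^ 2) := by ring
    have e2 : (S + N / 10 ^ 18) ^ 2 ≤ (N / 2) ^ 2 := by
      gcongr; linarith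
    have e3 : (S + N / 10 ^ 18) * S ≤ (N / 2) * (N / 2) := by
      gcongr <;> linarith
    have e4 : S ^ 2 ≤ (N / 2) ^ 2 := by
      gcongr; linarith
    have : N / 10 ^ 18 * ((S + N / 10 ^ 18) ^ 2 + (S + N / 10 ^ 18) * S + S ^ 2) ≤
        N / 10 ^ 18 * N ^ 2 := by
      gcongr
      nlinarith
    linarith [show N / 10 ^ 18 * N ^ 2 = N ^ 3 / 10 ^ 18 by ring]
  have h7 : X ^ 3 ≤ (S + N / 10 ^ 18) ^ 3 := by gcongr
  have h8 : 27 * X ^ 3 - F ≤ 40 * (N ^ 3 / 10 ^ 18) := by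
    have : N * 10 ^ 40 ≤ N ^ 3 := by linarith
    linarith
  have h9 : N / 8 ≤ X := by
    by_contra! h
    have : X ^ 3 ≤ (N / 8) ^ 3 := by gcongr
    have : (N / 8) ^ 3 = N ^ 3 / 512 := by ring
    have : (13 / 45 * N) ^ 3 = 2197 / 91125 * N ^ 3 := by ring
    linarith
  have h10 : Y ≤ 100000 * (N ^ 3 / 10 ^ 18) := by
    by_contra! h
    have e1 : 36 * N ^ 2 * (27 * X ^ 3 - F) ≤ 36 * N ^ 2 * (40 * (N ^ 3 / 10 ^ 18)) := by gcongr
    have : 0 ≤ Y := le_trans (by positivity) h.le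
    have e2 : 100000 * (N ^ 3 / 10 ^ 18) * (N / 8) ^ 2 ≤ Y * X ^ 2 := by gcongr
    have e3 : 0 < N ^ 3 / 10 ^ 18 * N ^ 2 := by positivity
    nlinarith
  have h11 : N / 10000 ≤ 3 * (S + N / 10 ^ 18) - L := by linarith
  have h12 : (N / 10000) ^ 3 ≤ (3 * (S + N / 10 ^ 18) - L) ^ 3 := by gcongr
  have h13 : (3 * (S + N / 10 ^ 18)) ^ 3 = 27 * (S + N / 10 ^ 18) ^ 3 := by ring
  have h14 : (N / 10000) ^ 3 = N ^ 3 / 10 ^ 12 := by ring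
  linarith

lemma six_mul_choose_three_real (s : ℕ) :
    (6 * (3 * s + 1).choose 3 : ℝ) = 27 * (s : ℝ) ^ 3 - 3 * s := by
  have h : ((3 * s : ℕ) + 1 : ℝ) * (3 * s).choose 2 = (3 * s + 1).choose 3 * 3 := by
    exact_mod_cast Nat.add_one_mul_choose_eq (3 * s) 2
  rw [Nat.cast_choose_two] at h
  push_cast at h
  linarith

variable {n K s : ℕ} {H : Finset (Finset (Fin n))}

/-- A shifted family missing some triple of the first `L` vertices has no member beyond them. -/
lemma IsShifted.exists_lt_of_missing (hH : IsShifted H) (h3 : H ⊆ completeEdges n 3) {L : ℕ}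
    {e₀ : Finset (Fin n)} (he₀ : e₀ ∈ powersetCard 3 (belowFin n L)) (hmiss : e₀ ∉ H)
    {e : Finset (Fin n)} (he : e ∈ H) : ∃ y ∈ e, (y : ℕ) < L := by
  by_contra! hno
  rw [mem_powersetCard] at he₀
  refine hmiss (hH.mem_of_exchange he (he₀.2.trans (mem_powersetCard.1 (h3 he)).2.symm)
    fun y hy x hx => ?_)
  have h1 := mem_belowFin.1 (he₀.1 (mem_sdiff.1 hy).1)
  have h2 := hno x (mem_sdiff.1 hx).1
  exact Fin.lt_def.2 (by omega)

/-- A dense shifted family contains all triples of an initial segment of almost `3 * s`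
vertices. -/
lemma IsShifted.initial_clique (hH : IsShifted H) (h3 : H ⊆ completeEdges n 3)
    (hν : ∀ M ⊆ H, IsMatchingFam M → #M ≤ s) (hK : 10 ^ 18 ≤ K) (hn : K ^ 4 ≤ n)
    (hs : 13 * n ≤ 45 * s) (hsn : 3 * s ≤ n) (hcard : (3 * s + 1).choose 3 ≤ #H) :
    ∀ e ∈ powersetCard 3 (belowFin n (3 * s - s / 1000)), e ∈ H := by
  classical
  intro e₀ he₀
  by_contra hmiss
  have hmeet := fun e he => hH.exists_lt_of_missing (e := e) h3 he₀ hmiss he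
  set L := 3 * s - s / 1000 with hLdef
  set b := n / K with hb
  have hK0 : 0 < K := by omega
  have hKK : K * K ≤ n := by
    refine le_trans ?_ hn
    rw [← sq]
    exact Nat.pow_le_pow_right hK0 (by norm_num)
  have hKb : K * b ≤ n := Nat.mul_div_le n K
  have hKleb : K ≤ b := (Nat.le_div_iff_mul_le hK0).2 hKK
  have hb0 : 0 < b := by omega
  have hnlt : n < (K + 1) * b := by
    have h1 := Nat.div_add_mod n K
    have h2 := Nat.mod_lt n hK0
    rw [← hb] at h1
    rw [add_mul, one_mul]
    omega
  set E : Finset (Fin 3 → Fin K) := {T | ∃ x : Fin 3 → Fin n, Function.Injective x ∧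
    univ.image x ∈ H ∧ ∀ j, (x j : ℕ) / b = T j + 1} with hE
  have hEx : ∀ T ∈ E, ∃ x : Fin 3 → Fin n, Function.Injective x ∧ univ.image x ∈ H ∧
      ∀ j, ((T j : ℕ) + 1) * b ≤ x j := fun T hT => by
    obtain ⟨x, h1, h2, h3⟩ := (mem_filter.1 hT).2
    exact ⟨x, h1, h2, fun j => by rw [← h3 j]; exact Nat.div_mul_le_self _ _⟩
  have hcover : ∀ x ∈ orderedEdges H, (∃ j, (x j : ℕ) < b) ∨
      ∃ T ∈ E, ∀ j, (x j : ℕ) / b = T j + 1 := fun x hx => by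
    rw [or_iff_not_imp_left]
    intro hno
    push Not at hno
    have h1 : ∀ j, 1 ≤ (x j : ℕ) / b := fun j =>
      (Nat.le_div_iff_mul_le hb0).2 (by simpa using hno j)
    have h2 : ∀ j, (x j : ℕ) / b < K + 1 := fun j =>
      (Nat.div_lt_iff_lt_mul hb0).2 ((x j).2.trans hnlt)
    have h3 : ∀ j, (x j : ℕ) / b = (x j : ℕ) / b - 1 + 1 := fun j => by have := h1 j; omega
    obtain ⟨hx1, hx2⟩ := mem_orderedEdges.1 hx
    let T : Fin 3 → Fin K := fun j => ⟨(x j : ℕ) / b - 1, by have := h1 j; have := h2 j; omega⟩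
    exact ⟨T, mem_filter.2 ⟨mem_univ _, x, hx1, hx2, h3⟩, h3⟩
  have hbn : b ≤ n := Nat.div_le_self _ _
  have hsix : 27 * (s : ℝ) ^ 3 - 3 * s ≤ #(orderedEdges H) := by
    rw [← six_mul_choose_three_real]
    exact_mod_cast (Nat.mul_le_mul_left 6 hcard).trans (six_mul_card_le_card_orderedEdges h3)
  have hOle : (#(orderedEdges H) : ℝ) ≤ 3 * b * n ^ 2 + #E * b ^ 3 := by
    have : orderedEdges H ⊆ ({x | ∃ j, (x j : ℕ) < b} : Finset (Fin 3 → Fin n)) ∪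
        ({x | ∃ T ∈ E, ∀ j, (x j : ℕ) / b = T j + 1} : Finset (Fin 3 → Fin n)) := fun x hx => by
      simpa using hcover x hx
    exact_mod_cast (card_le_card this).trans ((card_union_le _ _).trans
      (add_le_add (card_filter_exists_lt_le hbn) (card_filter_exists_block_le hb0 E)))
  have hKr : (10 : ℝ) ^ 18 ≤ K := by exact_mod_cast hK
  have hKbr : (K : ℝ) * b ≤ n := by exact_mod_cast hKb
  have hnr : (K : ℝ) ^ 4 ≤ n := by exact_mod_cast hn
  have hKr0 : (0 : ℝ) < K := by exact_mod_cast hK0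
  have hbr0 : (0 : ℝ) < b := by exact_mod_cast hb0
  have hn20 : (10 : ℝ) ^ 20 ≤ n := by
    refine le_trans ?_ hnr
    calc (10 : ℝ) ^ 20 ≤ (10 ^ 18) ^ 4 := by norm_num
      _ ≤ (K : ℝ) ^ 4 := by gcongr
  have hsr : 13 * (n : ℝ) ≤ 45 * s := by exact_mod_cast hs
  have hsnr : 3 * (s : ℝ) ≤ n := by exact_mod_cast hsn
  have hB : (b : ℝ) ≤ n / 10 ^ 18 := by
    rw [le_div_iff₀ (by positivity), mul_comm]
    exact le_trans (by gcongr) hKbr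
  have hK3 : (K : ℝ) ^ 3 ≤ n / 10 ^ 18 := by
    rw [le_div_iff₀ (by positivity)]
    calc (K : ℝ) ^ 3 * 10 ^ 18 ≤ (K : ℝ) ^ 3 * K := by gcongr
      _ = (K : ℝ) ^ 4 := by ring
      _ ≤ n := hnr
  rcases E.eq_empty_or_nonempty with hE0 | hE0
  · refine sparse_blocks_absurd hn20 hsr hsnr hB (F := 0) (by positivity) (hsix.trans ?_)
    simpa [hE0] using hOle
  obtain ⟨m, hm, hload, hstr⟩ := exists_fractional_structure hE0
  have hround := hH.sum_fractional_mul_le hν hKb hEx m hm hload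
  set ν := ∑ T, m T with hνdef
  rw [Fintype.card_fin] at hstr
  rcases hstr with hsmall | ⟨Q, hQ, hbad⟩
  · refine sparse_blocks_absurd hn20 hsr hsnr hB ?_ (hsix.trans hOle)
    calc (#E : ℝ) * b ^ 3 ≤ 27 / (347 / 100) ^ 3 * (K : ℝ) ^ 3 * (b : ℝ) ^ 3 := by gcongr
      _ = 27 / (347 / 100) ^ 3 * ((K : ℝ) * b) ^ 3 := by ring
      _ ≤ _ := by gcongr
  set bad : Finset (Fin 3 → Fin K) := {T ∈ E | ¬ ∀ j, T j ∈ Q} with hbaddef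
  have hν0 : 0 ≤ ν := sum_nonneg fun T _ => hm T
  have hEν : (#E : ℝ) ≤ 27 * ν ^ 3 := by
    by_contra! h
    have h1 : 36 * (K : ℝ) ^ 2 * (27 * ν ^ 3 - #E) < 0 :=
      mul_neg_of_pos_of_neg (by positivity) (by linarith)
    have h2 : 0 ≤ (#bad : ℝ) * ν ^ 2 := by positivity
    linarith
  set V : Finset (Fin n) := {y | ∃ v ∈ Q, (y : ℕ) / b = v + 1} with hV
  have hVcard : (#V : ℝ) ≤ 3 * (s + n / 10 ^ 18) := by
    calc (#V : ℝ) ≤ #Q * b := by exact_mod_cast card_filter_mem_block_le hb0 Q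
      _ ≤ 3 * ν * b := by gcongr
      _ = 3 * (ν * b) := by ring
      _ ≤ 3 * (s + n / 10 ^ 18) := by gcongr; linarith
  have hLle : (L : ℝ) ≤ 3 * s := by exact_mod_cast Nat.sub_le _ _
  have hLr : (L : ℝ) ≤ 3 * s - s / 1000 + 1 := by
    have h2 : 1000 * L + s ≤ 3000 * s + 1000 := by omega
    have h3 : 1000 * (L : ℝ) + s ≤ 3000 * s + 1000 := by exact_mod_cast h2
    linarith
  have hO' : (#(orderedEdges H) : ℝ) ≤ 3 * b * n ^ 2 + #bad * b ^ 3 +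
      ((3 * (s + n / 10 ^ 18)) ^ 3 - (3 * (s + n / 10 ^ 18) - L) ^ 3 : ℝ) := by
    have hsub : orderedEdges H ⊆ (({x | ∃ j, (x j : ℕ) < b} : Finset (Fin 3 → Fin n)) ∪
        ({x | ∃ T ∈ bad, ∀ j, (x j : ℕ) / b = T j + 1} : Finset (Fin 3 → Fin n))) ∪
        ({x | (∀ j, x j ∈ V) ∧ ∃ j, (x j : ℕ) < L} : Finset (Fin 3 → Fin n)) := fun x hx => by
      simp only [mem_union, mem_filter, mem_univ, true_and]
      rcases hcover x hx with h | ⟨T, hT, hTx⟩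
      · exact Or.inl (Or.inl h)
      · by_cases hTQ : ∀ j, T j ∈ Q
        · refine Or.inr ⟨fun j => mem_filter.2 ⟨mem_univ _, T j, hTQ j, hTx j⟩, ?_⟩
          obtain ⟨y, hy, hyL⟩ := hmeet _ (mem_orderedEdges.1 hx).2
          obtain ⟨j, -, rfl⟩ := mem_image.1 hy
          exact ⟨j, hyL⟩
        · exact Or.inl (Or.inr ⟨T, mem_filter.2 ⟨hT, hTQ⟩, hTx⟩)
    have h1 := (card_le_card hsub).trans ((card_union_le _ _).trans (Nat.add_le_add_right
      ((card_union_le _ _).trans (add_le_add (card_filter_exists_lt_le hbn)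
        (card_filter_exists_block_le hb0 bad))) _))
    have h2 := card_filter_forall_mem_exists_lt_le (L := L) (L' := L) V le_rfl
      (by have : (0 : ℝ) ≤ n / 10 ^ 18 := by positivity
          linarith) hVcard
    refine le_trans (by exact_mod_cast h1) (add_le_add_right h2 _)
  refine near_clique_blocks_absurd (X := ν * b) (Y := #bad * b ^ 3) hn20 hsr hsnr hB
    (by positivity) (hround.trans (by linarith)) ?_ ?_ (hsix.trans hOle) hLr (hsix.trans hO')
  · calc (#E : ℝ) * b ^ 3 ≤ 27 * ν ^ 3 * b ^ 3 := by gcongr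
      _ = _ := by ring
  · have h27 : 0 ≤ 27 * ν ^ 3 - #E := by linarith
    calc (#bad : ℝ) * b ^ 3 * (ν * b) ^ 2 = #bad * ν ^ 2 * b ^ 5 := by ring
      _ ≤ 36 * K ^ 2 * (27 * ν ^ 3 - #E) * b ^ 5 := by gcongr
      _ = 36 * (K * b) ^ 2 * ((27 * ν ^ 3 - #E) * b ^ 3) := by ring
      _ ≤ 36 * (n : ℝ) ^ 2 * ((27 * ν ^ 3 - #E) * b ^ 3) := by gcongr
      _ = _ := by ring

end InitialClique

/-- Stability: if a 3-graph `H` on `n` vertices with `13n/45 ≤ s ≤ (1-c₀)n/3` has matching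
number at most `s` and more than `binom(3s+1,3) + 3s(n-3s-1)` edges, then `H` is a subgraph
of `D³_{n,s}`. -/
theorem stability_large_s_clique :
    ∃ cstar : ℝ, 0 < cstar ∧ ∀ c0 : ℝ, 0 < c0 → c0 < cstar →
      ∃ n0 : ℕ, 0 < n0 ∧ ∀ n s : ℕ, n0 < n →
        13 * (n : ℝ) / 45 ≤ (s : ℝ) → (s : ℝ) ≤ (1 - c0) * (n : ℝ) / 3 →
        ∀ H ⊆ completeEdges n 3,
          (∀ M ⊆ H, IsMatchingFam M → M.card ≤ s) →
          (3 * s + 1).choose 3 + 3 * s * (n - 3 * s - 1) < H.card →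
          ∃ U : Finset (Fin n), U.card = 3 * s + 2 ∧ ∀ e ∈ H, e ⊆ U := by
  refine ⟨1, one_pos, fun c0 hc0 _ => ⟨(10 ^ 18) ^ 4 + ⌈10 / c0⌉₊, by positivity, ?_⟩⟩
  intro n s hn hs hsc H h3 hν hcard
  have hgap : 10 ≤ c0 * n := by
    have h1 := Nat.le_ceil (10 / c0)
    have h2 : (⌈10 / c0⌉₊ : ℝ) ≤ n := by exact_mod_cast (Nat.le_add_left _ _).trans hn.le
    have := (div_le_iff₀ hc0).1 (h1.trans h2)
    linarith
  have hsn : 3 * s + 10 ≤ n := by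
    have : 3 * (s : ℝ) + 10 ≤ n := by linarith
    exact_mod_cast this
  have hsn' : 13 * n ≤ 45 * s := by
    have : 13 * (n : ℝ) ≤ 45 * s := by linarith
    exact_mod_cast this
  have hbig : (10 ^ 18) ^ 4 ≤ n := (Nat.le_add_right _ _).trans hn.le
  have hs5 : 100000 ≤ s := by
    have : 10 ^ 6 ≤ n := le_trans (by norm_num) hbig
    omega
  refine exists_clique_of_shifted (D := n - 3 * s - 1) (by omega) (by omega) ?_ H h3 hν hcard
  intro G hG hGs hGν hGcard
  refine ⟨belowFin n (3 * s + 2), card_belowFin (by omega), ?_⟩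
  exact hGs.subset_belowFin (L := 3 * s - s / 1000) hG (by omega) (by omega) hs5 (by omega)
    (by omega) (hGs.initial_clique hG hGν le_rfl hbig hsn' (by omega)
      ((Nat.le_add_right _ _).trans hGcard.le)) hGν hGcard
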